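/- arXiv:2402.02714 — 2 statements merged into one kernel-verified Lean document; each statement's English description precedes it below -/
import Mathlib

section
/- Let H ∈ (0, 1/2), α > 0, β > 0, and let N be a positive integer. Set A = (1/H + 1/(3/2 − H))^(1/2), m = ⌈(β/A)√N⌉, n = ⌊(A/β)√N⌋, ζ_0 = exp(−α√N/((3/2 − H)A)), ζ_n = exp(α√N/(H A)), and ζ_i = ζ_0 (ζ_n/ζ_0)^(i/n) for i = 0, …, n. Then there exist nonnegative weights ω_1, …, ω_{nm} and nodes λ_1, …, λ_{nm} ∈ [ζ_0, ζ_n] such that for every t > 0, | (1/Γ(1/2 − H)) ∫_{ζ_0}^{ζ_n} e^(−x t) x^(−H−1/2) dx − Σ_{j=1}^{nm} ω_j e^(−λ_j t) | ≤ (5π³/18)^(1/2) · n (e^(αβ) − 1) t^(H − 1/2) / (Γ(1/2 − H) · 2^(2m+1) · m^H) · exp( (2β/A)√N · log(e^(αβ) − 1) ). -/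
open MeasureTheory Real Set Finset


section Gauss
open Polynomial

lemma aux_diag {V : Type*} [NormedAddCommGroup V] [InnerProductSpace ℝ V] [FiniteDimensional ℝ V]
    {m : ℕ} (hm : Module.finrank ℝ V = m) (B : V →ₗ[ℝ] V →ₗ[ℝ] ℝ) (hB : ∀ p q, B p q = B q p) :
    ∃ (e : OrthonormalBasis (Fin m) ℝ V) (l : Fin m → ℝ),
      ∀ i q, B (e i) q = l i * inner ℝ (e i) q := by
  have : CompleteSpace V := FiniteDimensional.complete ℝ V
  let T : V →ₗ[ℝ] V :=
    { toFun := fun p => (InnerProductSpace.toDual ℝ V).symm (LinearMap.toContinuousLinearMap (B p))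
      map_add' := by intro x y; simp
      map_smul' := by intro c x; simp }
  have hT : ∀ p q, inner ℝ (T p) q = B p q := by
    intro p q
    simp [T, InnerProductSpace.toDual_symm_apply]
  have hs : T.IsSymmetric := by
    intro p q
    rw [hT, real_inner_comm, hT, hB]
  refine ⟨hs.eigenvectorBasis hm, hs.eigenvalues hm, ?_⟩
  intro i q
  rw [← hT, hs.apply_eigenvectorBasis hm i, inner_smul_left]
  simp

lemma gauss_exists (L : ℝ[X] →ₗ[ℝ] ℝ) (a b : ℝ) (hpos : ∀ p : ℝ[X], p ≠ 0 → 0 < L (p * p))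
    (ha : ∀ p : ℝ[X], 0 ≤ L ((X - C a) * (p * p))) (hb : ∀ p : ℝ[X], 0 ≤ L ((C b - X) * (p * p)))
    (m : ℕ) (hm : 1 ≤ m) :
    ∃ ω l : Fin m → ℝ, (∀ i, 0 ≤ ω i) ∧ (∀ i, l i ∈ Set.Icc a b) ∧
      ∀ P : ℝ[X], P.natDegree < 2 * m → L P = ∑ i, ω i * P.eval (l i) := by
  let V := degreeLT ℝ m
  let cd : InnerProductSpace.Core ℝ V :=
    { inner := fun p q => L ((p : ℝ[X]) * (q : ℝ[X]))
      conj_inner_symm := by intro x y; simp [mul_comm]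
      re_inner_nonneg := by
        intro x
        by_cases h : (x : ℝ[X]) = 0
        · simp [h]
        · exact (hpos _ h).le
      add_left := by intro x y z; simp [add_mul]
      smul_left := by intro x y r; simp
      definite := by
        intro x hx
        by_contra h
        have := hpos (x : ℝ[X]) (by simpa using h)
        exact absurd hx this.ne' }
  let : NormedAddCommGroup V := cd.toNormedAddCommGroup
  let : InnerProductSpace ℝ V := InnerProductSpace.ofCore cd.toCore
  have hin : ∀ p q : V, inner ℝ p q = L ((p : ℝ[X]) * (q : ℝ[X])) := fun p q => rfl
  have : FiniteDimensional ℝ V := (degreeLTEquiv ℝ m).symm.finiteDimensional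
  have hfr : Module.finrank ℝ V = m := by
    rw [(degreeLTEquiv ℝ m).finrank_eq]; simp
  let B : V →ₗ[ℝ] V →ₗ[ℝ] ℝ := LinearMap.mk₂ ℝ (fun p q => L (X * ((p : ℝ[X]) * (q : ℝ[X]))))
    (by intro x y z; simp [add_mul, mul_add]) (by intro c x y; simp)
    (by intro x y z; simp [mul_add]) (by intro c x y; simp)
  have hBv : ∀ p q : V, B p q = L (X * ((p : ℝ[X]) * (q : ℝ[X]))) := fun p q => rfl
  obtain ⟨e, l, he⟩ := aux_diag hfr B (by intro p q; rw [hBv, hBv, mul_comm (p : ℝ[X])])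
  have hmem : ∀ k, k < m → (X ^ k : ℝ[X]) ∈ V := by
    intro k hk
    exact mem_degreeLT.mpr (by rw [degree_X_pow]; exact_mod_cast hk)
  let c : Fin m → ℝ := fun i => L (e i : ℝ[X])
  -- pairing of monomials with eigenvectors
  have hc : ∀ i k, k < m → L (X ^ k * (e i : ℝ[X])) = l i ^ k * c i := by
    intro i k
    induction k with
    | zero => intro _; simp [c]
    | succ k ih =>
      intro hk
      have h1 := he i ⟨X ^ k, hmem k (by omega)⟩
      rw [hBv, hin] at h1
      have h2 := ih (by omega)
      simp only at h1
      rw [mul_comm (e i : ℝ[X])] at h1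
      rw [h2] at h1
      rw [pow_succ', mul_assoc, h1]; ring
  have hexp : ∀ p q : V, L ((p : ℝ[X]) * (q : ℝ[X])) = ∑ i, L ((p : ℝ[X]) * (e i : ℝ[X])) * L ((q : ℝ[X]) * (e i : ℝ[X])) := by
    intro p q
    have := (e.sum_inner_mul_inner p q).symm
    simp only [hin] at this
    rw [this]
    refine Finset.sum_congr rfl fun i _ => ?_
    rw [mul_comm (e i : ℝ[X]) (q : ℝ[X])]
  have hexpB : ∀ p q : V, L (X * ((p : ℝ[X]) * (q : ℝ[X]))) =
      ∑ i, l i * L ((p : ℝ[X]) * (e i : ℝ[X])) * L ((q : ℝ[X]) * (e i : ℝ[X])) := by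
    intro p q
    have h0 : B p q = B (∑ i, inner ℝ (e i) p • e i) q := by rw [e.sum_repr' p]
    rw [← hBv, h0, map_sum, LinearMap.sum_apply]
    refine Finset.sum_congr rfl fun i _ => ?_
    rw [map_smul, LinearMap.smul_apply, he, hin, hin, mul_comm (e i : ℝ[X]) (p : ℝ[X]),
      mul_comm (e i : ℝ[X]) (q : ℝ[X]), smul_eq_mul]
    ring
  have hnorm : ∀ i, L ((e i : ℝ[X]) * (e i : ℝ[X])) = 1 := by
    intro i
    have := e.orthonormal.1 i
    have h2 := real_inner_self_eq_norm_sq (e i)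
    rw [this, hin] at h2
    simpa using h2
  have hself : ∀ i, L (X * ((e i : ℝ[X]) * (e i : ℝ[X]))) = l i := by
    intro i
    have := he i (e i)
    rw [hBv, hin, hnorm] at this
    simpa using this
  have hmono : ∀ k, k < 2 * m → L (X ^ k) = ∑ i, c i ^ 2 * l i ^ k := by
    intro k hk
    by_cases h : k < m
    · have := hexp ⟨X ^ k, hmem k h⟩ ⟨X ^ 0, hmem 0 (by omega)⟩
      simp only [] at this
      rw [pow_zero, mul_one] at this
      rw [this]
      refine Finset.sum_congr rfl fun i _ => ?_
      rw [hc i k h, one_mul]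
      simp only [c]; ring
    · have := hexpB ⟨X ^ (k - m), hmem _ (by omega)⟩ ⟨X ^ (m - 1), hmem _ (by omega)⟩
      simp only [] at this
      have e1 : (X : ℝ[X]) * (X ^ (k - m) * X ^ (m - 1)) = X ^ k := by
        rw [← pow_add, ← pow_succ']; congr 1; omega
      rw [e1] at this
      rw [this]
      refine Finset.sum_congr rfl fun i _ => ?_
      rw [hc i _ (by omega), hc i _ (by omega)]
      have e2 : l i ^ k = l i * (l i ^ (k - m) * l i ^ (m - 1)) := by
        rw [← pow_add, ← pow_succ']; congr 1; omega
      rw [e2]; ring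
  refine ⟨fun i => c i ^ 2, l, fun i => sq_nonneg _, fun i => ⟨?_, ?_⟩, ?_⟩
  · have := ha (e i : ℝ[X])
    rw [sub_mul, map_sub, hself, C_mul', map_smul, hnorm] at this
    simp at this; linarith
  · have := hb (e i : ℝ[X])
    rw [sub_mul, map_sub, hself, C_mul', map_smul, hnorm] at this
    simp at this; linarith
  · intro P hP
    conv_lhs => rw [P.as_sum_range_C_mul_X_pow]
    rw [map_sum]
    simp_rw [C_mul', map_smul, eval_eq_sum_range, Finset.mul_sum]
    rw [Finset.sum_comm]
    refine Finset.sum_congr rfl fun k hk => ?_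
    rw [hmono k (by have := Finset.mem_range.mp hk; omega), smul_eq_mul, Finset.mul_sum]
    refine Finset.sum_congr rfl fun i _ => ?_
    ring

lemma step_div (f : ℝ[X]) (s : ℝ) (hs : 0 ≤ s) : (∀ i, 0 ≤ f.coeff i) →
    ∃ (Q : ℝ[X]) (c : ℝ), f = (X - C s) * Q + C c ∧ (∀ i, 0 ≤ Q.coeff i) ∧ 0 ≤ c := by
  induction f using Polynomial.recOnHorner with
  | M0 => intro _; exact ⟨0, 0, by simp, by simp, le_rfl⟩
  | MC p a h0 ha ih =>
    intro h
    have hp : ∀ i, 0 ≤ p.coeff i := by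
      intro i
      rcases Nat.eq_zero_or_pos i with rfl | hi
      · rw [h0]
      · have := h i
        rwa [coeff_add, coeff_C_of_ne_zero (by omega), add_zero] at this
    obtain ⟨Q, c, h1, h2, h3⟩ := ih hp
    have : 0 ≤ a := by simpa [h0] using h 0
    exact ⟨Q, c + a, by rw [h1, C_add]; ring, h2, by linarith⟩
  | MX p hp0 ih =>
    intro h
    obtain ⟨Q, c, h1, h2, h3⟩ := ih (fun i => by simpa using h (i + 1))
    refine ⟨Q * X + C c, s * c, ?_, ?_, by positivity⟩
    · conv_lhs => rw [h1]
      rw [C_mul]; ring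
    · intro i
      rcases i with _ | i
      · simpa using h3
      · simpa [coeff_C] using h2 i

lemma multi_div (S : Multiset ℝ) (hS : ∀ s ∈ S, 0 ≤ s) : ∀ f : ℝ[X], (∀ i, 0 ≤ f.coeff i) →
    ∃ Q R : ℝ[X], f = (S.map (fun s => X - C s)).prod * Q + R ∧ (∀ i, 0 ≤ Q.coeff i) ∧
      (R.degree < S.card) := by
  induction S using Multiset.induction_on with
  | empty => intro f hf; exact ⟨f, 0, by simp, hf, by simp⟩
  | cons a S ih =>
    intro f hf
    obtain ⟨Q, R, h1, h2, h3⟩ := ih (fun s hs => hS s (Multiset.mem_cons_of_mem hs)) f hf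
    obtain ⟨Q', c, h4, h5, h6⟩ := step_div Q a (hS a (Multiset.mem_cons_self a S)) h2
    refine ⟨Q', (S.map (fun s => X - C s)).prod * C c + R, ?_, h5, ?_⟩
    · rw [Multiset.map_cons, Multiset.prod_cons, h1, h4]; ring
    · rw [Multiset.card_cons]
      refine lt_of_le_of_lt (degree_add_le _ _) (max_lt ?_ ?_)
      · have : ((S.map (fun s => X - C s)).prod * C c).degree ≤ S.card := by
          refine (degree_mul_le _ _).trans ?_
          calc _ ≤ (S.card : WithBot ℕ) + 0 := by
                gcongr
                · refine degree_le_natDegree.trans ?_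
                  rw [natDegree_multiset_prod_X_sub_C_eq_card]
                · exact degree_C_le
            _ = _ := by simp
        exact lt_of_le_of_lt this (by exact_mod_cast Nat.lt_succ_self _)
      · exact lt_trans h3 (by exact_mod_cast Nat.lt_succ_self _)

end Gauss

section Err
open Polynomial

lemma hs_congr {f g : ℕ → ℝ} {a : ℝ} (h : HasSum f a) (hfg : ∀ k, f k = g k) : HasSum g a := by
  have : f = g := funext hfg
  rwa [← this]

lemma contOn_rpow (u b : ℝ) : ContinuousOn (fun x : ℝ => x ^ (-u)) (Set.Icc 1 b) := by
  intro x hx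
  exact (Real.continuousAt_rpow_const x (-u) (Or.inl (by linarith [hx.1]))).continuousWithinAt

lemma intvl_mul (u b : ℝ) (hb : 1 < b) (f : ℝ → ℝ) (hf : ContinuousOn f (Set.Icc 1 b)) :
    IntervalIntegrable (fun x => f x * x ^ (-u)) volume 1 b := by
  apply ContinuousOn.intervalIntegrable
  rw [Set.uIcc_of_le hb.le]
  exact hf.mul (contOn_rpow u b)

lemma gauss_real (u b : ℝ) (hb : 1 < b) (m : ℕ) (hm : 1 ≤ m) :
    ∃ ω l : Fin m → ℝ, (∀ i, 0 ≤ ω i) ∧ (∀ i, l i ∈ Set.Icc 1 b) ∧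
      ∀ P : ℝ[X], P.natDegree < 2 * m →
        ∫ x in (1 : ℝ)..b, P.eval x * x ^ (-u) = ∑ i, ω i * P.eval (l i) := by
  have hIntg : ∀ P : ℝ[X], IntervalIntegrable (fun x => P.eval x * x ^ (-u)) volume 1 b :=
    fun P => intvl_mul u b hb _ P.continuous.continuousOn
  let L : ℝ[X] →ₗ[ℝ] ℝ :=
    { toFun := fun P => ∫ x in (1 : ℝ)..b, P.eval x * x ^ (-u)
      map_add' := by
        intro P Q
        rw [← intervalIntegral.integral_add (hIntg P) (hIntg Q)]
        congr 1; ext x; simp; ring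
      map_smul' := by
        intro c P
        simp [mul_assoc] }
  have hL : ∀ P, L P = ∫ x in (1 : ℝ)..b, P.eval x * x ^ (-u) := fun P => rfl
  have hnn : ∀ P : ℝ[X], (∀ x ∈ Set.Icc 1 b, 0 ≤ P.eval x) → 0 ≤ L P := by
    intro P hP
    rw [hL]
    apply intervalIntegral.integral_nonneg hb.le
    intro x hx
    have : 0 < x := by linarith [hx.1]
    exact mul_nonneg (hP x hx) (by positivity)
  have g1 : ∀ p : ℝ[X], p ≠ 0 → 0 < L (p * p) := by
    intro p hp
    rw [hL]
    apply intervalIntegral.integral_pos hb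
    · exact (p * p).continuous.continuousOn.mul (contOn_rpow u b)
    · intro x hx
      have : 0 < x := by linarith [hx.1]
      rw [eval_mul]
      exact mul_nonneg (mul_self_nonneg _) (by positivity)
    · have hinf : (Set.Icc 1 b).Infinite := Set.Icc_infinite hb
      obtain ⟨x, hx, hx'⟩ := (hinf.sdiff (p.roots.toFinset.finite_toSet)).nonempty
      refine ⟨x, hx, ?_⟩
      have hx0 : 0 < x := by linarith [hx.1]
      have hne : eval x p ≠ 0 := by
        intro h0
        apply hx'
        simp [hp, h0]
      rw [eval_mul]
      exact mul_pos (mul_self_pos.mpr hne) (by positivity)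
  have g2 : ∀ p : ℝ[X], 0 ≤ L ((X - C 1) * (p * p)) := by
    intro p
    apply hnn
    intro x hx
    simp only [eval_mul, eval_sub, eval_X, eval_C]
    exact mul_nonneg (by linarith [hx.1]) (mul_self_nonneg _)
  have g3 : ∀ p : ℝ[X], 0 ≤ L ((C b - X) * (p * p)) := by
    intro p
    apply hnn
    intro x hx
    simp only [eval_mul, eval_sub, eval_X, eval_C]
    exact mul_nonneg (by linarith [hx.2]) (mul_self_nonneg _)
  exact gauss_exists L 1 b g1 g2 g3 m hm

variable {u b : ℝ} {m : ℕ} {ω l : Fin m → ℝ}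

lemma err_pow_nonneg (hb : 1 < b) (hl : ∀ i, l i ∈ Set.Icc 1 b)
    (hex : ∀ P : ℝ[X], P.natDegree < 2 * m →
        ∫ x in (1 : ℝ)..b, P.eval x * x ^ (-u) = ∑ i, ω i * P.eval (l i)) (hm : 1 ≤ m) (k : ℕ) :
    ∑ i, ω i * (b - l i) ^ k ≤ ∫ x in (1 : ℝ)..b, (b - x) ^ k * x ^ (-u) := by
  let M : Multiset ℝ := (Finset.univ : Finset (Fin m)).val.map (fun i => b - l i)
  obtain ⟨Q, R, h1, h2, h3⟩ := multi_div (M + M) (by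
    intro s hs
    have : s ∈ M := by simpa using hs
    obtain ⟨i, _, rfl⟩ := Multiset.mem_map.mp this
    linarith [(hl i).2]) (X ^ k) (by intro i; rw [coeff_X_pow]; split_ifs <;> norm_num)
  have hD : ∀ y : ℝ, y ^ k = (∏ i, (y - (b - l i))) ^ 2 * Q.eval y + R.eval y := by
    intro y
    have := congrArg (eval y) h1
    rw [eval_pow, eval_X] at this
    rw [this, eval_add, eval_mul, Multiset.map_add, Multiset.prod_add, eval_mul, sq]
    have : eval y (Multiset.map (fun s => X - C s) M).prod = ∏ i, (y - (b - l i)) := by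
      rw [eval_multiset_prod]
      simp [M, Finset.prod, Function.comp_def]
    rw [this]
  have hR : (R.comp (C b - X)).natDegree < 2 * m := by
    rw [natDegree_comp]
    have e1 : (C b - X : ℝ[X]).natDegree = 1 := by
      rw [show (C b - X : ℝ[X]) = -(X - C b) by ring, natDegree_neg, natDegree_X_sub_C]
    rw [e1, mul_one]
    by_cases hR0 : R = 0
    · simp [hR0]; omega
    · rw [natDegree_lt_iff_degree_lt hR0]
      simpa [M, two_mul] using h3
  have hexR := hex _ hR
  simp only [eval_comp, eval_sub, eval_C, eval_X] at hexR
  have e1 : ∑ i, ω i * (b - l i) ^ k = ∑ i, ω i * R.eval (b - l i) := by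
    refine Finset.sum_congr rfl fun i _ => ?_
    rw [hD (b - l i), Finset.prod_eq_zero (Finset.mem_univ i) (by simp)]
    simp
  rw [e1, ← hexR]
  apply intervalIntegral.integral_mono_on hb.le
  · exact intvl_mul u b hb (fun x => R.eval (b - x))
      (R.continuous.comp (continuous_const.sub continuous_id)).continuousOn
  · exact intvl_mul u b hb (fun x => (b - x) ^ k) (by fun_prop)
  · intro x hx
    have hx0 : 0 < x := by linarith [hx.1]
    have hQ : 0 ≤ Q.eval (b - x) := by
      rw [eval_eq_sum_range]
      exact Finset.sum_nonneg fun i _ => mul_nonneg (h2 i) (pow_nonneg (by linarith [hx.2]) _)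
    apply mul_le_mul_of_nonneg_right _ (by positivity)
    rw [hD (b - x)]
    have := mul_nonneg (sq_nonneg (∏ i, (b - x - (b - l i)))) hQ
    linarith

lemma err_inv (hb : 1 < b) (hω : ∀ i, 0 ≤ ω i) (hl : ∀ i, l i ∈ Set.Icc 1 b)
    (hex : ∀ P : ℝ[X], P.natDegree < 2 * m →
        ∫ x in (1 : ℝ)..b, P.eval x * x ^ (-u) = ∑ i, ω i * P.eval (l i)) (hm : 1 ≤ m)
    (p : ℝ[X]) (hp : p.natDegree ≤ m) (hp0 : p.eval 0 ≠ 0) :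
    (∫ x in (1 : ℝ)..b, x⁻¹ * x ^ (-u)) - ∑ i, ω i * (l i)⁻¹ ≤
      ∫ x in (1 : ℝ)..b, ((p.eval x / p.eval 0) ^ 2 / x) * x ^ (-u) := by
  set D := C (((p.eval 0) ^ 2)⁻¹) * divX (p * p) with hD
  have hdeg : D.natDegree < 2 * m := by
    refine lt_of_le_of_lt (natDegree_C_mul_le _ _) ?_
    rw [natDegree_divX_eq_natDegree_tsub_one]
    have := natDegree_mul_le (p := p) (q := p)
    omega
  have key : ∀ x : ℝ, 0 < x → x⁻¹ = (p.eval x / p.eval 0) ^ 2 / x - D.eval x := by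
    intro x hx
    have h1 := congrArg (eval x) (divX_mul_X_add (p * p))
    simp only [eval_add, eval_mul, eval_X, eval_C, mul_coeff_zero] at h1
    rw [coeff_zero_eq_eval_zero] at h1
    rw [hD, eval_mul, eval_C]
    have h2 : eval x (divX (p * p)) = (eval x p * eval x p - eval 0 p * eval 0 p) / x := by
      field_simp; linarith
    rw [h2]
    field_simp
    ring
  have hexD := hex D hdeg
  have hc : ContinuousOn (fun x => (p.eval x / p.eval 0) ^ 2 / x) (Set.Icc 1 b) := by
    apply ContinuousOn.div
    · exact ((p.continuous.div_const _).pow 2).continuousOn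
    · exact continuousOn_id
    · intro x hx; linarith [hx.1]
  have e1 : (∫ x in (1 : ℝ)..b, x⁻¹ * x ^ (-u)) =
      (∫ x in (1 : ℝ)..b, ((p.eval x / p.eval 0) ^ 2 / x) * x ^ (-u)) -
      ∫ x in (1 : ℝ)..b, D.eval x * x ^ (-u) := by
    rw [← intervalIntegral.integral_sub (intvl_mul u b hb _ hc)
      (intvl_mul u b hb _ D.continuous.continuousOn)]
    apply intervalIntegral.integral_congr
    intro x hx
    rw [Set.uIcc_of_le hb.le] at hx
    simp only
    rw [key x (by linarith [hx.1])]
    ring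
  have e2 : ∑ i, ω i * (l i)⁻¹ = (∑ i, ω i * ((p.eval (l i) / p.eval 0) ^ 2 / l i)) -
      ∑ i, ω i * D.eval (l i) := by
    rw [← Finset.sum_sub_distrib]
    refine Finset.sum_congr rfl fun i _ => ?_
    rw [key (l i) (by linarith [(hl i).1])]
    ring
  have e3 : 0 ≤ ∑ i, ω i * ((p.eval (l i) / p.eval 0) ^ 2 / l i) := by
    refine Finset.sum_nonneg fun i _ => mul_nonneg (hω i) ?_
    have : 0 < l i := by linarith [(hl i).1]
    positivity
  rw [e1, e2, hexD]
  linarith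

lemma hasSum_err (hb : 1 < b) (hl : ∀ i, l i ∈ Set.Icc 1 b) (c : ℕ → ℝ) (hc : ∀ k, 0 ≤ c k)
    (f : ℝ → ℝ) (hf : ∀ y ∈ Set.Icc 0 (b - 1), HasSum (fun k => c k * y ^ k) (f y)) :
    HasSum (fun k => c k * ((∫ x in (1 : ℝ)..b, (b - x) ^ k * x ^ (-u)) -
      ∑ i, ω i * (b - l i) ^ k))
      ((∫ x in (1 : ℝ)..b, f (b - x) * x ^ (-u)) - ∑ i, ω i * f (b - l i)) := by
  have h1 : HasSum (fun k => ∑ i, ω i * (c k * (b - l i) ^ k)) (∑ i, ω i * f (b - l i)) := by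
    apply hasSum_sum
    intro i _
    exact (hf _ ⟨by linarith [(hl i).2], by linarith [(hl i).1]⟩).mul_left _
  have h2 : HasSum (fun k => ∫ x in (1 : ℝ)..b, c k * (b - x) ^ k * x ^ (-u))
      (∫ x in (1 : ℝ)..b, f (b - x) * x ^ (-u)) := by
    obtain ⟨K, hK⟩ := isCompact_Icc.exists_bound_of_continuousOn (contOn_rpow u b)
    have hK0 : 0 ≤ K := (norm_nonneg _).trans (hK 1 ⟨le_rfl, hb.le⟩)
    apply intervalIntegral.hasSum_integral_of_dominated_convergence
      (fun k _ => c k * (b - 1) ^ k * K)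
    · intro k
      rw [Set.uIoc_of_le hb.le]
      exact (intvl_mul u b hb (fun x => c k * (b - x) ^ k) (by fun_prop)).1.aestronglyMeasurable
    · intro k
      refine Filter.Eventually.of_forall fun x hx => ?_
      rw [Set.uIoc_of_le hb.le] at hx
      rw [norm_mul]
      have h0 : 0 ≤ b - x := by linarith [hx.2]
      have h00 : 0 ≤ c k * (b - x) ^ k := mul_nonneg (hc k) (pow_nonneg h0 k)
      apply mul_le_mul _ (hK x ⟨hx.1.le, hx.2⟩) (norm_nonneg _)
        (mul_nonneg (hc k) (pow_nonneg (by linarith) k))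
      rw [Real.norm_of_nonneg h00]
      exact mul_le_mul_of_nonneg_left (pow_le_pow_left₀ h0 (by linarith [hx.1]) k) (hc k)
    · refine Filter.Eventually.of_forall fun x _ => ?_
      exact ((hf (b - 1) ⟨by linarith, le_rfl⟩).mul_right K).summable
    · exact intervalIntegrable_const
    · refine Filter.Eventually.of_forall fun x hx => ?_
      rw [Set.uIoc_of_le hb.le] at hx
      exact (hf (b - x) ⟨by linarith [hx.2], by linarith [hx.1]⟩).mul_right _
  refine hs_congr (h2.sub h1) fun k => ?_
  symm
  rw [mul_sub, ← intervalIntegral.integral_const_mul, Finset.mul_sum]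
  congr 1
  · congr 1; ext x; ring
  · refine Finset.sum_congr rfl fun i _ => ?_
    ring

lemma err_main (hb : 1 < b) (hω : ∀ i, 0 ≤ ω i) (hl : ∀ i, l i ∈ Set.Icc 1 b)
    (hex : ∀ P : ℝ[X], P.natDegree < 2 * m →
        ∫ x in (1 : ℝ)..b, P.eval x * x ^ (-u) = ∑ i, ω i * P.eval (l i)) (hm : 1 ≤ m)
    (δ S : ℝ) (hS : ∀ k : ℕ, 2 * m ≤ k → ∀ τ : ℝ, 0 < τ →
      τ ^ ((k : ℝ) + δ) * Real.exp (-τ) / (Nat.factorial k) ≤ S)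
    (p : ℝ[X]) (hp : p.natDegree ≤ m) (hp0 : p.eval 0 ≠ 0) (t : ℝ) (ht : 0 < t) :
    |(∫ x in (1 : ℝ)..b, Real.exp (-x * t) * x ^ (-u)) - ∑ i, ω i * Real.exp (-(l i) * t)| * t ^ δ
      ≤ S * b ^ (1 - δ) * ∫ x in (1 : ℝ)..b, ((p.eval x / p.eval 0) ^ 2 / x) * x ^ (-u) := by
  have hb0 : 0 < b := by linarith
  set μ : ℕ → ℝ := fun k => (∫ x in (1 : ℝ)..b, (b - x) ^ k * x ^ (-u)) -
      ∑ i, ω i * (b - l i) ^ k with hμ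
  have hμ0 : ∀ k, 0 ≤ μ k := fun k => sub_nonneg.mpr (err_pow_nonneg hb hl hex hm k)
  have hμz : ∀ k, k < 2 * m → μ k = 0 := by
    intro k hk
    have := hex ((C b - X) ^ k) (by
      refine lt_of_le_of_lt natDegree_pow_le ?_
      have e1 : (C b - X : ℝ[X]).natDegree = 1 := by
        rw [show (C b - X : ℝ[X]) = -(X - C b) by ring, natDegree_neg, natDegree_X_sub_C]
      rw [e1, mul_one]; exact hk)
    simp only [eval_pow, eval_sub, eval_C, eval_X] at this
    simp only [hμ]
    rw [this, sub_self]
  have A1 := hasSum_err (u := u) (ω := ω) hb hl (fun k => Real.exp (-(b * t)) * (t ^ k / (Nat.factorial k)))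
    (fun k => by positivity) (fun y => Real.exp (-(b * t)) * Real.exp (t * y)) (by
      intro y _
      have := (NormedSpace.expSeries_div_hasSum_exp (t * y)).mul_left (Real.exp (-(b * t)))
      rw [← Real.exp_eq_exp_ℝ] at this
      refine hs_congr this fun k => ?_
      rw [mul_pow]; ring)
  have A2 := hasSum_err (u := u) (ω := ω) hb hl (fun k => b⁻¹ * (b⁻¹) ^ k)
    (fun k => by positivity) (fun y => (b - y)⁻¹) (by
      intro y hy
      have hlt : b⁻¹ * y < 1 := by
        rw [inv_mul_lt_iff₀ hb0]; linarith [hy.2]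
      have := (hasSum_geometric_of_lt_one (mul_nonneg (inv_nonneg.mpr hb0.le) hy.1) hlt).mul_left b⁻¹
      have e : (b - y)⁻¹ = b⁻¹ * (1 - b⁻¹ * y)⁻¹ := by
        rw [← mul_inv]; congr 1; field_simp
      rw [e]
      refine hs_congr this fun k => ?_
      rw [mul_pow]; ring)
  have f1 : ∀ x : ℝ, Real.exp (-(b * t)) * Real.exp (t * (b - x)) = Real.exp (-x * t) := by
    intro x; rw [← Real.exp_add]; congr 1; ring
  simp only [f1] at A1
  simp only [sub_sub_cancel] at A2
  have hE0 := A1.nonneg (fun k => mul_nonneg (by positivity) (hμ0 k))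
  rw [abs_of_nonneg hE0]
  have hfin := err_inv (u := u) hb hω hl hex hm p hp hp0
  have hS0 : 0 ≤ S := le_trans (by positivity) (hS (2 * m) le_rfl 1 one_pos)
  refine le_trans ?_ (mul_le_mul_of_nonneg_left hfin (by positivity))
  have B1 := A1.mul_right (t ^ δ)
  have B2 := A2.mul_left (S * b ^ (1 - δ))
  refine hasSum_le ?_ B1 B2
  intro k
  by_cases hk : k < 2 * m
  · have := hμz k hk
    simp only [hμ] at this
    rw [this]; simp
  · push Not at hk
    have h := hS k hk (b * t) (by positivity)
    have hμk := hμ0 k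
    simp only [hμ] at hμk
    rw [mul_right_comm, ← mul_assoc]
    apply mul_le_mul_of_nonneg_right _ hμk
    rw [Real.mul_rpow hb0.le ht.le, Real.rpow_add hb0, Real.rpow_add ht, Real.rpow_natCast,
      Real.rpow_natCast] at h
    rw [Real.rpow_sub hb0, Real.rpow_one]
    have hbk : 0 < b ^ k * b ^ δ := by positivity
    have : S * (b / b ^ δ) * (b⁻¹ * b⁻¹ ^ k) = S / (b ^ k * b ^ δ) := by
      rw [inv_pow]; field_simp
    rw [this, le_div_iff₀ hbk]
    refine le_trans (le_of_eq ?_) h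
    ring

end Err

section SLemma

lemma pow_exp_le (k : ℕ) (τ : ℝ) (hτ : 0 < τ) (hk : 1 ≤ k) :
    τ ^ k * Real.exp (-τ) / (Nat.factorial k) * √(2 * π * k) ≤ 1 := by
  have hk0 : (0 : ℝ) < k := by exact_mod_cast hk
  have h1 : τ ^ k * Real.exp (-τ) ≤ (k / Real.exp 1) ^ k := by
    have h2 : τ / k ≤ Real.exp (τ / k - 1) := by
      have := Real.add_one_le_exp (τ / k - 1)
      linarith
    have h3 : (τ / k) ^ k ≤ Real.exp (τ - k) := by
      calc (τ / k) ^ k ≤ (Real.exp (τ / k - 1)) ^ k :=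
            pow_le_pow_left₀ (by positivity) h2 k
        _ = Real.exp (τ - k) := by
            rw [← Real.exp_nat_mul]; congr 1; field_simp
    have h4 : (Real.exp 1) ^ k = Real.exp k := by
      rw [← Real.exp_nat_mul, mul_one]
    rw [div_pow] at h3 ⊢
    rw [h4]
    rw [div_le_iff₀ (by positivity)] at h3
    rw [le_div_iff₀ (by positivity)]
    calc τ ^ k * Real.exp (-τ) * Real.exp k = τ ^ k * Real.exp (k - τ) := by
          rw [mul_assoc, ← Real.exp_add]; congr 2; ring
      _ ≤ (Real.exp (τ - k) * k ^ k) * Real.exp (k - τ) := by gcongr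
      _ = k ^ k := by
          rw [mul_right_comm, ← Real.exp_add]; simp
  have h5 := Stirling.le_factorial_stirling k
  rw [div_mul_eq_mul_div, div_le_one (by positivity)]
  calc τ ^ k * Real.exp (-τ) * √(2 * π * k) ≤ (k / Real.exp 1) ^ k * √(2 * π * k) := by gcongr
    _ = √(2 * π * k) * (k / Real.exp 1) ^ k := mul_comm _ _
    _ ≤ _ := h5

lemma S_lemma (H : ℝ) (hH : H ∈ Set.Ioo (0 : ℝ) (1 / 2)) (m : ℕ) (hm : 1 ≤ m) (k : ℕ)
    (hk : 2 * m ≤ k) (τ : ℝ) (hτ : 0 < τ) :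
    τ ^ ((k : ℝ) + (1 / 2 - H)) * Real.exp (-τ) / (Nat.factorial k) ≤
      (0.442 : ℝ) ^ (1 - 2 * H) * (0.2822 : ℝ) ^ (2 * H) * (m : ℝ) ^ (-H) := by
  obtain ⟨hH0, hH1⟩ := hH
  have hm0 : (0 : ℝ) < m := by exact_mod_cast hm
  have hk2 : (2 : ℝ) * m ≤ k := by exact_mod_cast hk
  have hk2' : (2 : ℝ) ≤ k := by
    have : (1 : ℝ) ≤ m := by exact_mod_cast hm
    linarith
  have hk0 : (0 : ℝ) < k := by linarith
  set a := τ ^ k * Real.exp (-τ) / (Nat.factorial k) with ha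
  have ha0 : 0 < a := by positivity
  have hpi := Real.pi_gt_d4
  have b1 : a ≤ 0.399 * (√k)⁻¹ := by
    have := pow_exp_le k τ hτ (by omega)
    rw [← ha, Real.sqrt_mul (by positivity)] at this
    have hs : 1 / 0.399 ≤ √(2 * π) := by
      apply Real.le_sqrt_of_sq_le; norm_num; linarith
    rw [← div_eq_mul_inv, le_div_iff₀ (by positivity)]
    have h' : a * (1 / 0.399 * √k) ≤ 1 := le_trans (by gcongr) this
    linarith
  have b2 : τ * a ≤ 0.489 * √k := by
    have h := pow_exp_le (k + 1) τ hτ (by omega)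
    rw [Nat.factorial_succ] at h
    push_cast at h
    have e : τ ^ (k + 1) * Real.exp (-τ) / (((k : ℝ) + 1) * (Nat.factorial k)) =
        τ * a / (k + 1) := by rw [ha]; field_simp; ring
    rw [e, Real.sqrt_mul (by positivity), div_mul_eq_mul_div, div_le_one (by positivity)] at h
    have hs : √(3 / 2) / 0.489 ≤ √(2 * π) := by
      apply Real.le_sqrt_of_sq_le
      rw [div_pow, Real.sq_sqrt (by norm_num)]; norm_num; linarith
    have hs2 : √((k : ℝ) + 1) ≤ √(3 / 2) * √k := by
      rw [← Real.sqrt_mul (by norm_num)]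
      apply Real.sqrt_le_sqrt; linarith
    have hq : √((k : ℝ) + 1) * √((k : ℝ) + 1) = k + 1 := Real.mul_self_sqrt (by positivity)
    have hp : 0 < √((k : ℝ) + 1) := by positivity
    have h6 : τ * a * √(2 * π) ≤ √((k : ℝ) + 1) := by
      by_contra hcon
      push Not at hcon
      have := mul_lt_mul_of_pos_right hcon hp
      nlinarith
    have h7 : τ * a * (√(3 / 2) / 0.489) ≤ √(3 / 2) * √k :=
      le_trans (le_trans (by gcongr) h6) hs2
    have h8 : 0 < √(3 / 2 : ℝ) := by positivity
    rw [show τ * a * (√(3 / 2) / 0.489) = √(3/2) * (τ * a / 0.489) by ring] at h7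
    have := le_of_mul_le_mul_left h7 h8
    rw [div_le_iff₀ (by norm_num)] at this
    linarith
  have e1 : τ ^ ((k : ℝ) + (1 / 2 - H)) * Real.exp (-τ) / (Nat.factorial k) =
      (τ * a) ^ (1 / 2 - H) * a ^ (1 / 2 + H) := by
    rw [Real.mul_rpow hτ.le ha0.le, mul_assoc, ← Real.rpow_add ha0,
      show (1 / 2 - H + (1 / 2 + H)) = 1 by ring, Real.rpow_one, Real.rpow_add hτ,
      Real.rpow_natCast, ha]
    ring
  rw [e1]
  have e2 : (τ * a) ^ (1 / 2 - H) * a ^ (1 / 2 + H) ≤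
      (0.489 * √k) ^ (1 / 2 - H) * (0.399 * (√k)⁻¹) ^ (1 / 2 + H) := by
    apply mul_le_mul (Real.rpow_le_rpow (by positivity) b2 (by linarith))
      (Real.rpow_le_rpow (by positivity) b1 (by linarith)) (by positivity) (by positivity)
  refine e2.trans ?_
  have hsk : 0 < √(k : ℝ) := by positivity
  have hskr : √(k : ℝ) = (k : ℝ) ^ (1 / 2 : ℝ) := Real.sqrt_eq_rpow _
  rw [Real.mul_rpow (by norm_num) hsk.le, Real.mul_rpow (by norm_num) (by positivity),
    Real.inv_rpow hsk.le, ← Real.rpow_neg hsk.le]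
  have e3 : (√(k : ℝ)) ^ (1 / 2 - H) * (√(k : ℝ)) ^ (-(1 / 2 + H)) = (k : ℝ) ^ (-H) := by
    rw [← Real.rpow_add hsk, hskr, ← Real.rpow_mul hk0.le]; congr 1; ring
  have e4 : (k : ℝ) ^ (-H) ≤ (2 : ℝ) ^ (-H) * (m : ℝ) ^ (-H) := by
    rw [← Real.mul_rpow (by norm_num) hm0.le]
    exact Real.rpow_le_rpow_of_nonpos (by positivity) hk2 (by linarith)
  have e5 : (0.489 : ℝ) ^ (1 / 2 - H) * (0.399 : ℝ) ^ (1 / 2 + H) * (2 : ℝ) ^ (-H) ≤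
      (0.442 : ℝ) ^ (1 - 2 * H) * (0.2822 : ℝ) ^ (2 * H) := by
    have i1 : (0.442 : ℝ) ^ (1 - 2 * H) = ((0.442 : ℝ) ^ 2) ^ (1 / 2 - H) := by
      rw [← Real.rpow_natCast, ← Real.rpow_mul (by norm_num)]; congr 1; push_cast; ring
    have i2 : (0.2822 : ℝ) ^ (2 * H) = ((0.2822 : ℝ) ^ 2) ^ H := by
      rw [← Real.rpow_natCast, ← Real.rpow_mul (by norm_num)]; norm_num
    have i3 : (0.399 : ℝ) ^ (1 / 2 + H) = (0.399 : ℝ) ^ (1 / 2 - H) * ((0.399 : ℝ) ^ 2) ^ H := by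
      rw [← Real.rpow_natCast, ← Real.rpow_mul (by norm_num), ← Real.rpow_add (by norm_num)]
      congr 1; push_cast; ring
    rw [i1, i2, i3, Real.rpow_neg (by norm_num), ← Real.inv_rpow (by norm_num), ← mul_assoc,
      ← Real.mul_rpow (by norm_num) (by norm_num), mul_assoc,
      ← Real.mul_rpow (by norm_num) (by norm_num)]
    apply mul_le_mul (Real.rpow_le_rpow (by norm_num) (by norm_num) (by linarith))
      (Real.rpow_le_rpow (by norm_num) (by norm_num) (by linarith)) (by positivity) (by positivity)
  calc _ = (0.489 : ℝ) ^ (1 / 2 - H) * (0.399 : ℝ) ^ (1 / 2 + H) *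
        ((√(k : ℝ)) ^ (1 / 2 - H) * (√(k : ℝ)) ^ (-(1 / 2 + H))) := by ring
    _ ≤ (0.489 : ℝ) ^ (1 / 2 - H) * (0.399 : ℝ) ^ (1 / 2 + H) *
        ((2 : ℝ) ^ (-H) * (m : ℝ) ^ (-H)) := by rw [e3]; gcongr
    _ = (0.489 : ℝ) ^ (1 / 2 - H) * (0.399 : ℝ) ^ (1 / 2 + H) * (2 : ℝ) ^ (-H) *
        (m : ℝ) ^ (-H) := by ring
    _ ≤ _ := by gcongr

end SLemma

section Core
open Polynomial

lemma interval_core (H : ℝ) (hH : H ∈ Set.Ioo (0 : ℝ) (1 / 2)) (m : ℕ) (hm : 1 ≤ m)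
    (R : ℝ) (hR : 1 < R) (p : ℝ[X]) (hp : p.natDegree ≤ m) (hp0 : p.eval 0 ≠ 0) (K : ℝ)
    (hK0 : 0.442 * ∫ x in (1 : ℝ)..R ^ 2, (p.eval x / p.eval 0) ^ 2 * (R * x ^ (-(3 / 2) : ℝ)) ≤ K)
    (hK1 : 0.2822 * ∫ x in (1 : ℝ)..R ^ 2, (p.eval x / p.eval 0) ^ 2 * (R ^ 2 * x ^ (-2 : ℝ)) ≤ K) :
    ∃ ω l : Fin m → ℝ, (∀ i, 0 ≤ ω i) ∧ (∀ i, l i ∈ Set.Icc 1 (R ^ 2)) ∧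
      ∀ t : ℝ, 0 < t →
      |(∫ x in (1 : ℝ)..R ^ 2, Real.exp (-x * t) * x ^ (-(H + 1 / 2))) -
        ∑ i, ω i * Real.exp (-(l i) * t)| * t ^ (1 / 2 - H) ≤ K * (m : ℝ) ^ (-H) := by
  have hb : 1 < R ^ 2 := by nlinarith
  have hm0 : (0 : ℝ) < m := by exact_mod_cast hm
  obtain ⟨ω, l, h1, h2, h3⟩ := gauss_real (H + 1 / 2) (R ^ 2) hb m hm
  refine ⟨ω, l, h1, h2, fun t ht => ?_⟩
  have hmain := err_main hb h1 h2 h3 hm (1 / 2 - H) _ (S_lemma H hH m hm) p hp hp0 t ht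
  refine hmain.trans ?_
  obtain ⟨hH0, hH1⟩ := hH
  set P : ℝ → ℝ := fun x => p.eval x / p.eval 0 with hP
  have hPc : Continuous P := p.continuous.div_const _
  have hcr : ∀ r : ℝ, ContinuousOn (fun x : ℝ => x ^ r) (Set.uIcc 1 (R ^ 2)) := by
    intro r x hx
    rw [Set.uIcc_of_le hb.le] at hx
    exact (Real.continuousAt_rpow_const x r (Or.inl (by linarith [hx.1]))).continuousWithinAt
  have hi : ∀ c r : ℝ, IntervalIntegrable (fun x => P x ^ 2 * (c * x ^ r)) volume 1 (R ^ 2) := by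
    intro c r
    apply ContinuousOn.intervalIntegrable
    exact (hPc.pow 2).continuousOn.mul (continuousOn_const.mul (hcr r))
  have hpt : ∀ x ∈ Set.Icc 1 (R ^ 2),
      (0.442 : ℝ) ^ (1 - 2 * H) * (0.2822 : ℝ) ^ (2 * H) * (R ^ 2) ^ (H + 1 / 2) *
        ((P x) ^ 2 / x * x ^ (-(H + 1 / 2))) ≤
      (1 - 2 * H) * (0.442 * (P x ^ 2 * (R * x ^ (-(3 / 2) : ℝ)))) +
        2 * H * (0.2822 * (P x ^ 2 * (R ^ 2 * x ^ (-2 : ℝ)))) := by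
    intro x hx
    have hx0 : 0 < x := by linarith [hx.1]
    have hR0 : 0 < R := by linarith
    have am := Real.geom_mean_le_arith_mean2_weighted (w₁ := 1 - 2 * H) (w₂ := 2 * H)
      (p₁ := 0.442 * (R * x ^ (-(1 / 2) : ℝ))) (p₂ := 0.2822 * (R ^ 2 * x ^ (-1 : ℝ)))
      (by linarith) (by linarith) (by positivity) (by positivity) (by ring)
    have e1 : (0.442 * (R * x ^ (-(1 / 2) : ℝ))) ^ (1 - 2 * H) *
        (0.2822 * (R ^ 2 * x ^ (-1 : ℝ))) ^ (2 * H) =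
        (0.442 : ℝ) ^ (1 - 2 * H) * (0.2822 : ℝ) ^ (2 * H) *
          ((R ^ 2) ^ (H + 1 / 2) * x ^ (-(H + 1 / 2))) := by
      rw [Real.mul_rpow (x := (0.442 : ℝ)) (by norm_num) (by positivity),
        Real.mul_rpow (x := (0.2822 : ℝ)) (by norm_num) (by positivity),
        Real.mul_rpow hR0.le (by positivity),
        Real.mul_rpow (x := R ^ 2) (by positivity) (by positivity),
        ← Real.rpow_mul hx0.le, ← Real.rpow_mul hx0.le, ← Real.rpow_natCast R 2,
        ← Real.rpow_mul hR0.le, ← Real.rpow_mul hR0.le]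
      have i1 : R ^ (((2 : ℕ) : ℝ) * (H + 1 / 2)) =
          R ^ (1 - 2 * H) * R ^ (((2 : ℕ) : ℝ) * (2 * H)) := by
        rw [← Real.rpow_add hR0]; congr 1; push_cast; ring
      have i2 : x ^ (-(H + 1 / 2)) = x ^ (-(1 / 2) * (1 - 2 * H)) * x ^ (-1 * (2 * H)) := by
        rw [← Real.rpow_add hx0]; congr 1; ring
      rw [i1, i2]; ring
    rw [e1] at am
    have i3 : x ^ (-(3 / 2) : ℝ) = x ^ (-(1 / 2) : ℝ) / x := by
      rw [show (-(3 / 2) : ℝ) = -(1 / 2) - 1 by norm_num, Real.rpow_sub hx0, Real.rpow_one]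
    have i4 : x ^ (-2 : ℝ) = x ^ (-1 : ℝ) / x := by
      rw [show (-2 : ℝ) = -1 - 1 by norm_num, Real.rpow_sub hx0, Real.rpow_one]
    rw [i3, i4]
    have := mul_le_mul_of_nonneg_left am (show 0 ≤ P x ^ 2 / x by positivity)
    calc _ = P x ^ 2 / x * ((0.442 : ℝ) ^ (1 - 2 * H) * (0.2822 : ℝ) ^ (2 * H) *
          ((R ^ 2) ^ (H + 1 / 2) * x ^ (-(H + 1 / 2)))) := by ring
      _ ≤ _ := this
      _ = _ := by ring
  have hcl : ContinuousOn (fun x => (P x) ^ 2 / x * x ^ (-(H + 1 / 2))) (Set.uIcc 1 (R ^ 2)) := by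
    apply ContinuousOn.mul _ (hcr _)
    apply ContinuousOn.div (hPc.pow 2).continuousOn continuousOn_id
    intro x hx
    rw [Set.uIcc_of_le hb.le] at hx
    simp only [id]
    linarith [hx.1]
  have hIntg := intervalIntegral.integral_mono_on hb.le
    (hcl.intervalIntegrable.const_mul
      ((0.442 : ℝ) ^ (1 - 2 * H) * (0.2822 : ℝ) ^ (2 * H) * (R ^ 2) ^ (H + 1 / 2)))
    ((((hi R (-(3 / 2))).const_mul 0.442).const_mul (1 - 2 * H)).add
      (((hi (R ^ 2) (-2)).const_mul 0.2822).const_mul (2 * H))) hpt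
  rw [intervalIntegral.integral_add (((hi R (-(3 / 2))).const_mul 0.442).const_mul (1 - 2 * H))
      (((hi (R ^ 2) (-2)).const_mul 0.2822).const_mul (2 * H)),
    intervalIntegral.integral_const_mul, intervalIntegral.integral_const_mul,
    intervalIntegral.integral_const_mul, intervalIntegral.integral_const_mul,
    intervalIntegral.integral_const_mul] at hIntg
  have hfin : (1 - 2 * H) * (0.442 * ∫ x in (1 : ℝ)..R ^ 2, P x ^ 2 * (R * x ^ (-(3 / 2) : ℝ))) +
      2 * H * (0.2822 * ∫ x in (1 : ℝ)..R ^ 2, P x ^ 2 * (R ^ 2 * x ^ (-2 : ℝ))) ≤ K := by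
    have j0 := mul_le_mul_of_nonneg_left hK0 (show 0 ≤ 1 - 2 * H by linarith)
    have j1 := mul_le_mul_of_nonneg_left hK1 (show 0 ≤ 2 * H by linarith)
    linarith
  have := mul_le_mul_of_nonneg_right (hIntg.trans hfin) (show 0 ≤ (m : ℝ) ^ (-H) by positivity)
  refine le_trans (le_of_eq ?_) this
  rw [show 1 - (1 / 2 - H) = H + 1 / 2 by ring]
  ring

lemma int_rpow_a (R : ℝ) (hR : 1 < R) :
    ∫ x in (1 : ℝ)..R ^ 2, x ^ (-(3 / 2) : ℝ) = 2 * (1 - 1 / R) := by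
  have hR0 : 0 < R := by linarith
  have hb : 1 < R ^ 2 := by nlinarith
  rw [integral_rpow (Or.inr ⟨by norm_num, by
    rw [Set.uIcc_of_le hb.le]; intro h; linarith [h.1]⟩)]
  rw [← Real.rpow_natCast R 2, ← Real.rpow_mul hR0.le]
  norm_num
  rw [Real.rpow_neg_one]
  ring

lemma int_rpow_b (R : ℝ) (hR : 1 < R) :
    ∫ x in (1 : ℝ)..R ^ 2, x ^ (-2 : ℝ) = 1 - 1 / R ^ 2 := by
  have hR0 : 0 < R := by linarith
  have hb : 1 < R ^ 2 := by nlinarith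
  rw [integral_rpow (Or.inr ⟨by norm_num, by
    rw [Set.uIcc_of_le hb.le]; intro h; linarith [h.1]⟩)]
  norm_num
  rw [Real.rpow_neg_one]
  ring

lemma cheb_core (m : ℕ) (R : ℝ) (hR : 1 < R) :
    ∃ p : ℝ[X], p.natDegree ≤ m ∧ p.eval 0 ≠ 0 ∧
      ∀ x ∈ Set.Icc 1 (R ^ 2), (p.eval x / p.eval 0) ^ 2 ≤ 4 * ((R - 1) / (R + 1)) ^ (2 * m) := by
  have hR0 : 0 < R := by linarith
  set d := (R ^ 2 - 1) / 2 with hd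
  set c := (R ^ 2 + 1) / 2 with hc
  have hd0 : 0 < d := by rw [hd]; nlinarith
  refine ⟨(Chebyshev.T ℝ m).comp (C (c / d) - C (1 / d) * X), ?_, ?_⟩
  · refine natDegree_comp_le.trans ?_
    have h1 : (C (c / d) - C (1 / d) * X : ℝ[X]).natDegree ≤ 1 := by
      compute_degree
    have h2 : (Chebyshev.T ℝ m).natDegree = m := by
      simp
    rw [h2]
    nlinarith
  set ρ := (R - 1) / (R + 1) with hρ
  have hρ0 : 0 < ρ := div_pos (by linarith) (by linarith)
  have hcd : c / d = Real.cosh (Real.log ρ) := by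
    rw [Real.cosh_log hρ0, hρ, hc, hd]
    have : R - 1 ≠ 0 := by linarith
    have : R ^ 2 - 1 ≠ 0 := by nlinarith
    field_simp
    ring
  have h0 : eval 0 ((Chebyshev.T ℝ m).comp (C (c / d) - C (1 / d) * X)) =
      Real.cosh (m * Real.log ρ) := by
    rw [eval_comp]
    simp only [eval_sub, eval_mul, eval_C, eval_X, mul_zero, sub_zero]
    rw [hcd]
    simp
  have hlow : (ρ ^ m)⁻¹ / 2 ≤ Real.cosh (m * Real.log ρ) := by
    rw [← Real.log_pow, Real.cosh_log (by positivity)]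
    have : 0 < ρ ^ m := by positivity
    linarith
  rw [h0]
  refine ⟨(Real.cosh_pos _).ne', ?_⟩
  intro x hx
  have hnum : |eval x ((Chebyshev.T ℝ m).comp (C (c / d) - C (1 / d) * X))| ≤ 1 := by
    rw [eval_comp]
    apply Chebyshev.abs_eval_T_real_le_one
    simp only [eval_sub, eval_mul, eval_C, eval_X]
    rw [show c / d - 1 / d * x = (c - x) / d by ring, abs_le]
    constructor
    · rw [le_div_iff₀ hd0]; rw [hc, hd]; linarith [hx.2]
    · rw [div_le_iff₀ hd0]; rw [hc, hd]; linarith [hx.1]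
  rw [div_pow]
  have hn2 : (eval x ((Chebyshev.T ℝ m).comp (C (c / d) - C (1 / d) * X))) ^ 2 ≤ 1 := by
    rw [← sq_abs]; exact pow_le_one₀ (abs_nonneg _) hnum
  have hl2 : ((ρ ^ m)⁻¹ / 2) ^ 2 ≤ Real.cosh (m * Real.log ρ) ^ 2 :=
    pow_le_pow_left₀ (by positivity) hlow 2
  calc _ ≤ 1 / ((ρ ^ m)⁻¹ / 2) ^ 2 := by
        apply div_le_div₀ zero_le_one hn2 (by positivity) hl2
    _ = 4 * ρ ^ (2 * m) := by
        rw [pow_mul', ]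
        field_simp
        norm_num

lemma cheb_J (m : ℕ) (R : ℝ) (hR : 1 < R) :
    ∃ p : ℝ[X], p.natDegree ≤ m ∧ p.eval 0 ≠ 0 ∧
      (∫ x in (1 : ℝ)..R ^ 2, (p.eval x / p.eval 0) ^ 2 * (R * x ^ (-(3 / 2) : ℝ))) ≤
        8 * ((R - 1) / (R + 1)) ^ (2 * m) * (R - 1) ∧
      (∫ x in (1 : ℝ)..R ^ 2, (p.eval x / p.eval 0) ^ 2 * (R ^ 2 * x ^ (-2 : ℝ))) ≤
        4 * ((R - 1) / (R + 1)) ^ (2 * m) * (R ^ 2 - 1) := by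
  obtain ⟨p, h1, h2, h3⟩ := cheb_core m R hR
  have hR0 : 0 < R := by linarith
  have hb : 1 < R ^ 2 := by nlinarith
  have hcr : ∀ r : ℝ, ContinuousOn (fun x : ℝ => x ^ r) (Set.uIcc 1 (R ^ 2)) := by
    intro r x hx
    rw [Set.uIcc_of_le hb.le] at hx
    exact (Real.continuousAt_rpow_const x r (Or.inl (by linarith [hx.1]))).continuousWithinAt
  have hgen : ∀ c r : ℝ, 0 ≤ c →
      (∫ x in (1 : ℝ)..R ^ 2, (p.eval x / p.eval 0) ^ 2 * (c * x ^ r)) ≤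
        4 * ((R - 1) / (R + 1)) ^ (2 * m) * (c * ∫ x in (1 : ℝ)..R ^ 2, x ^ r) := by
    intro c r hc
    rw [← intervalIntegral.integral_const_mul, ← intervalIntegral.integral_const_mul]
    apply intervalIntegral.integral_mono_on hb.le
    · apply ContinuousOn.intervalIntegrable
      exact ((p.continuous.div_const _).pow 2).continuousOn.mul (continuousOn_const.mul (hcr r))
    · apply ContinuousOn.intervalIntegrable
      exact continuousOn_const.mul (continuousOn_const.mul (hcr r))
    · intro x hx
      have : 0 < x := by linarith [hx.1]
      exact mul_le_mul_of_nonneg_right (h3 x hx) (by positivity)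
  refine ⟨p, h1, h2, (hgen _ _ hR0.le).trans (le_of_eq ?_),
    (hgen _ _ (by positivity)).trans (le_of_eq ?_)⟩
  · rw [int_rpow_a R hR]; field_simp; ring
  · rw [int_rpow_b R hR]; field_simp

lemma one_J (R : ℝ) (hR : 1 < R) :
    ∃ p : ℝ[X], p.natDegree ≤ 1 ∧ p.eval 0 ≠ 0 ∧
      (∫ x in (1 : ℝ)..R ^ 2, (p.eval x / p.eval 0) ^ 2 * (R * x ^ (-(3 / 2) : ℝ))) =
        2 / 3 * (R - 1) ^ 3 / R ∧
      (∫ x in (1 : ℝ)..R ^ 2, (p.eval x / p.eval 0) ^ 2 * (R ^ 2 * x ^ (-2 : ℝ))) =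
        2 * (R ^ 2 - 1) - 4 * R * Real.log R := by
  have hR0 : 0 < R := by linarith
  have hb : 1 < R ^ 2 := by nlinarith
  have hn0 : (0 : ℝ) ∉ Set.uIcc 1 (R ^ 2) := by
    rw [Set.uIcc_of_le hb.le]; intro h; linarith [h.1]
  have hcr : ∀ r : ℝ, IntervalIntegrable (fun x : ℝ => x ^ r) volume 1 (R ^ 2) :=
    fun r => intervalIntegral.intervalIntegrable_rpow (Or.inr hn0)
  refine ⟨X - C R, by rw [natDegree_X_sub_C], by simp; linarith, ?_, ?_⟩
  · have e : ∀ x ∈ Set.uIcc 1 (R ^ 2),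
        (eval x (X - C R) / eval 0 (X - C R)) ^ 2 * (R * x ^ (-(3 / 2) : ℝ)) =
        (1 / R) * x ^ (1 / 2 : ℝ) - 2 * x ^ (-(1 / 2) : ℝ) + R * x ^ (-(3 / 2) : ℝ) := by
      intro x hx
      rw [Set.uIcc_of_le hb.le] at hx
      have hx0 : 0 < x := by linarith [hx.1]
      have i1 : x ^ (1 / 2 : ℝ) = x ^ 2 * x ^ (-(3 / 2) : ℝ) := by
        rw [← Real.rpow_natCast, ← Real.rpow_add hx0]; norm_num
      have i2 : x ^ (-(1 / 2) : ℝ) = x * x ^ (-(3 / 2) : ℝ) := by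
        nth_rewrite 2 [← Real.rpow_one x]
        rw [← Real.rpow_add hx0]; norm_num
      rw [i1, i2]
      simp only [eval_sub, eval_X, eval_C, zero_sub, div_neg, neg_sq]
      field_simp
      ring
    rw [intervalIntegral.integral_congr e, intervalIntegral.integral_add
      (((hcr _).const_mul _).sub ((hcr _).const_mul _)) ((hcr _).const_mul _),
      intervalIntegral.integral_sub ((hcr _).const_mul _) ((hcr _).const_mul _),
      intervalIntegral.integral_const_mul, intervalIntegral.integral_const_mul,
      intervalIntegral.integral_const_mul, int_rpow_a R hR,
      integral_rpow (Or.inr ⟨by norm_num, hn0⟩), integral_rpow (Or.inr ⟨by norm_num, hn0⟩)]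
    rw [← Real.rpow_natCast R 2, ← Real.rpow_mul hR0.le, ← Real.rpow_mul hR0.le]
    have k1 : R ^ (((2 : ℕ) : ℝ) * (1 / 2 + 1)) = R ^ 3 := by
      rw [← Real.rpow_natCast]; norm_num
    have k2 : R ^ (((2 : ℕ) : ℝ) * (-(1 / 2) + 1)) = R := by
      norm_num
    rw [k1, k2, Real.one_rpow, Real.one_rpow]
    field_simp
    ring
  · have e : ∀ x ∈ Set.uIcc 1 (R ^ 2),
        (eval x (X - C R) / eval 0 (X - C R)) ^ 2 * (R ^ 2 * x ^ (-2 : ℝ)) =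
        1 * x ^ (0 : ℝ) - (2 * R) * x ^ (-1 : ℝ) + R ^ 2 * x ^ (-2 : ℝ) := by
      intro x hx
      rw [Set.uIcc_of_le hb.le] at hx
      have hx0 : 0 < x := by linarith [hx.1]
      have i1 : x ^ (0 : ℝ) = x ^ 2 * x ^ (-2 : ℝ) := by
        rw [← Real.rpow_natCast, ← Real.rpow_add hx0]; norm_num
      have i2 : x ^ (-1 : ℝ) = x * x ^ (-2 : ℝ) := by
        nth_rewrite 2 [← Real.rpow_one x]
        rw [← Real.rpow_add hx0]; norm_num
      rw [i1, i2]
      simp only [eval_sub, eval_X, eval_C, zero_sub, div_neg, neg_sq]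
      field_simp
      ring
    have k1 : ∫ x in (1 : ℝ)..R ^ 2, x ^ (-1 : ℝ) = 2 * Real.log R := by
      simp only [Real.rpow_neg_one]
      rw [integral_inv hn0, div_one, Real.log_pow]; norm_num
    rw [intervalIntegral.integral_congr e, intervalIntegral.integral_add
      (((hcr _).const_mul _).sub ((hcr _).const_mul _)) ((hcr _).const_mul _),
      intervalIntegral.integral_sub ((hcr _).const_mul _) ((hcr _).const_mul _),
      intervalIntegral.integral_const_mul, intervalIntegral.integral_const_mul,
      intervalIntegral.integral_const_mul, int_rpow_b R hR, k1,
      integral_rpow (Or.inr ⟨by norm_num, hn0⟩)]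
    norm_num
    field_simp
    ring

end Core

section Numeric

set_option maxHeartbeats 2000000 in
lemma G_bound (E z y : ℝ) (m n N : ℕ) (hE : 0 < E) (hz0 : 1 / 2 ≤ z) (hz1 : z < 1)
    (hm : 2 ≤ m) (hn : 1 ≤ n) (hy : 0 < y) (hN : 2 * z * n * y = N) (hzn : 2 * z * n < n + 1)
    (hym : y ≤ m) (hmy : (m : ℝ) < y + 1) :
    z ^ (2 * m + 1) * E ^ (2 * ((m : ℝ) - y)) ≤ 0.37 * (1 + z * E / 2) ^ (2 * m) ∧
    z ^ (2 * m + 1) * E ^ (2 * ((m : ℝ) - y)) * (1 + z * E / 2) ≤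
      0.6 * (1 + z * E / 2) ^ (2 * m) := by
  set w := z * E with hw
  have hw0 : 0 < w := by positivity
  set v := 1 + w / 2 with hv
  have hv1 : 1 ≤ v := by linarith
  have hv4 : v ^ 4 ≤ v ^ (2 * m) := pow_le_pow_right₀ hv1 (by omega)
  have hvm : 1 ≤ v ^ (2 * m) := one_le_pow₀ hv1
  set θ := (m : ℝ) - y with hθ
  have hθ0 : 0 ≤ θ := by linarith
  have hθ1 : θ < 1 := by linarith
  have hz00 : 0 < z := by linarith
  have hG0 : 0 < z ^ (2 * m + 1) * E ^ (2 * θ) := by positivity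
  rcases le_total 1 E with hE1 | hE1
  · have hEle : E ^ (2 * θ) ≤ E ^ 2 := by
      rw [← Real.rpow_natCast]
      apply Real.rpow_le_rpow_of_exponent_le hE1
      push_cast; linarith
    have hzle : z ^ (2 * m + 1) ≤ z ^ 2 := pow_le_pow_of_le_one hz00.le hz1.le (by omega)
    have hG : z ^ (2 * m + 1) * E ^ (2 * θ) ≤ w ^ 2 := by
      rw [hw, mul_pow]
      exact mul_le_mul hzle hEle (by positivity) (by positivity)
    have hwv : w = 2 * (v - 1) := by rw [hv]; ring
    constructor
    · have h1 : w ^ 2 ≤ 0.25 * v ^ 4 := by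
        have : w ≤ v ^ 2 / 2 := by rw [hwv]; nlinarith [sq_nonneg (v - 2)]
        have := pow_le_pow_left₀ hw0.le this 2
        nlinarith
      linarith
    · have h1 : w ^ 2 ≤ 0.6 * v ^ 3 := by
        rw [hwv]
        have : 0 ≤ (v - 3) ^ 2 * (v - 3 / 4) := mul_nonneg (sq_nonneg _) (by linarith)
        have : 0 < v ^ 3 := by positivity
        nlinarith
      have h2 := mul_le_mul_of_nonneg_right (hG.trans h1) (show 0 ≤ v by linarith)
      have h3 : v ^ 3 * v = v ^ 4 := by ring
      nlinarith
  · suffices h : z ^ (2 * m + 1) * E ^ (2 * θ) ≤ 0.37 * v ^ (2 * m) by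
      refine ⟨h, ?_⟩
      have hv15 : v ≤ 1.5 := by
        have : w ≤ 1 := by rw [hw]; nlinarith
        rw [hv]; linarith
      have := mul_le_mul h hv15 (by linarith) (by positivity)
      linarith
    have hw4 : w ≤ 0.37 * v ^ 4 := by
      have : 1 + 2 * w + 1.5 * w ^ 2 ≤ v ^ 4 := by
        have : v ^ 4 = 1 + 2 * w + 1.5 * w ^ 2 + w ^ 3 / 2 + w ^ 4 / 16 := by rw [hv]; ring
        rw [this]; have : 0 < w ^ 3 := by positivity
        have : 0 < w ^ 4 := by positivity
        linarith
      nlinarith [sq_nonneg (w - 1/4)]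
    rcases Nat.lt_or_ge 1 n with hn2 | hn1
    · have hn2' : (2 : ℝ) ≤ n := by exact_mod_cast hn2
      have hz34 : z ≤ 3 / 4 := by nlinarith
      have h1 : z ^ (2 * m + 1) ≤ z ^ 5 := pow_le_pow_of_le_one hz00.le hz1.le (by omega)
      have h2 : z ^ 5 ≤ (3 / 4) ^ 5 := pow_le_pow_left₀ hz00.le hz34 5
      have h3 : E ^ (2 * θ) ≤ 1 := Real.rpow_le_one hE.le hE1 (by linarith)
      have h4 : z ^ (2 * m + 1) * E ^ (2 * θ) ≤ (3 / 4) ^ 5 * 1 :=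
        mul_le_mul (h1.trans h2) h3 (by positivity) (by positivity)
      norm_num at h4
      linarith
    · have hn' : n = 1 := by omega
      rw [hn'] at hN
      push_cast at hN
      rw [mul_one] at hN
      rcases le_total (1 / 2) θ with hθ2 | hθ2
      · have h1 : z ^ (2 * m + 1) ≤ z ^ 1 := pow_le_pow_of_le_one hz00.le hz1.le (by omega)
        have h3 : E ^ (2 * θ) ≤ E ^ (1 : ℝ) :=
          Real.rpow_le_rpow_of_exponent_ge hE hE1 (by linarith)
        rw [Real.rpow_one] at h3
        rw [pow_one] at h1
        have h4 : z ^ (2 * m + 1) * E ^ (2 * θ) ≤ z * E :=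
          mul_le_mul h1 h3 (by positivity) (by positivity)
        linarith
      · have hNm : N ≤ 2 * m - 1 := by
          have : (N : ℝ) < 2 * m := by rw [← hN]; nlinarith
          have : N < 2 * m := by exact_mod_cast this
          omega
        have hNm' : (N : ℝ) ≤ 2 * m - 1 := by
          have : N + 1 ≤ 2 * m := by omega
          have : (N : ℝ) + 1 ≤ 2 * m := by exact_mod_cast this
          linarith
        have h1 : 1 - 2 * θ ≤ 2 * m * (1 - z) := by
          have : 1 - 2 * θ ≤ 2 * y * (1 - z) := by rw [hθ]; linarith
          refine this.trans ?_
          apply mul_le_mul_of_nonneg_right _ (by linarith)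
          linarith
        have h2 : z ^ (2 * m) ≤ Real.exp (-(1 - 2 * θ)) := by
          have : z ≤ Real.exp (z - 1) := by
            have := Real.add_one_le_exp (z - 1); linarith
          calc z ^ (2 * m) ≤ Real.exp (z - 1) ^ (2 * m) := pow_le_pow_left₀ hz00.le this _
            _ = Real.exp ((2 * m : ℕ) * (z - 1)) := by rw [← Real.exp_nat_mul]
            _ ≤ _ := by apply Real.exp_le_exp.mpr; push_cast; linarith
        have am := Real.geom_mean_le_arith_mean2_weighted (w₁ := 1 - 2 * θ) (w₂ := 2 * θ)
          (p₁ := Real.exp (-1)) (p₂ := E)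
          (by linarith) (by linarith) (by positivity) (by positivity) (by ring)
        rw [← Real.exp_mul] at am
        have h3 : z ^ (2 * m) * E ^ (2 * θ) ≤ (1 - 2 * θ) * Real.exp (-1) + 2 * θ * E := by
          refine le_trans ?_ am
          apply mul_le_mul_of_nonneg_right _ (by positivity)
          rw [show -1 * (1 - 2 * θ) = -(1 - 2 * θ) by ring]
          exact h2
        have h4 := mul_le_mul_of_nonneg_left h3 hz00.le
        have h5 : Real.exp (-1) < 0.37 := by
          have := Real.exp_neg_one_lt_d9; linarith
        have h6 : z * Real.exp (-1) ≤ 0.37 := by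
          have := Real.exp_pos (-1); nlinarith
        have h7 : z * ((1 - 2 * θ) * Real.exp (-1) + 2 * θ * E) ≤
            (1 - 2 * θ) * 0.37 + 2 * θ * w := by
          have := mul_le_mul_of_nonneg_left h6 (show 0 ≤ 1 - 2 * θ by linarith)
          rw [hw]; linarith
        have h8 : (1 - 2 * θ) * 0.37 ≤ (1 - 2 * θ) * (0.37 * v ^ (2 * m)) :=
          mul_le_mul_of_nonneg_left (by linarith only [hvm]) (by linarith only [hθ2])
        have h9 : 2 * θ * w ≤ 2 * θ * (0.37 * v ^ (2 * m)) :=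
          mul_le_mul_of_nonneg_left (by linarith only [hw4, hv4]) (by linarith only [hθ0])
        have h10 : z ^ (2 * m + 1) * E ^ (2 * θ) = z * (z ^ (2 * m) * E ^ (2 * θ)) := by ring
        rw [h10]
        linarith only [h4, h7, h8, h9]

lemma interval_two (H : ℝ) (hH : H ∈ Set.Ioo (0 : ℝ) (1 / 2)) (E z y : ℝ) (m n N : ℕ)
    (hE : 0 < E) (hz0 : 1 / 2 ≤ z) (hz1 : z < 1)
    (hm : 2 ≤ m) (hn : 1 ≤ n) (hy : 0 < y) (hN : 2 * z * n * y = N) (hzn : 2 * z * n < n + 1)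
    (hym : y ≤ m) (hmy : (m : ℝ) < y + 1) (R : ℝ) (hR : R = (1 + E) ^ z) :
    ∃ ω l : Fin m → ℝ, (∀ i, 0 ≤ ω i) ∧ (∀ i, l i ∈ Set.Icc 1 (R ^ 2)) ∧
      ∀ t : ℝ, 0 < t →
      |(∫ x in (1 : ℝ)..R ^ 2, Real.exp (-x * t) * x ^ (-(H + 1 / 2))) -
        ∑ i, ω i * Real.exp (-(l i) * t)| * t ^ (1 / 2 - H) ≤
        (1.465 * E ^ (1 + 2 * y) * (1 / 4) ^ m) * (m : ℝ) ^ (-H) := by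
  have hz00 : 0 < z := by linarith
  have hR1 : 1 < R := by rw [hR]; exact Real.one_lt_rpow (by linarith) hz00
  have hRw : R ≤ 1 + z * E := by
    rw [hR]
    exact _root_.rpow_one_add_le_one_add_mul_self (by linarith) hz00.le hz1.le
  obtain ⟨p, hp1, hp2, hJ0, hJ1⟩ := cheb_J m R hR1
  obtain ⟨g1, g2⟩ := G_bound E z y m n N hE hz0 hz1 hm hn hy hN hzn hym hmy
  set w := z * E with hw
  have hw0 : 0 < w := by positivity
  set v := 1 + w / 2 with hv
  have hv0 : 0 < v := by linarith
  have hρ : (R - 1) / (R + 1) ≤ (w / 2) / v := by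
    rw [div_le_div_iff₀ (by linarith) hv0, hv]
    nlinarith
  have hρ0 : 0 ≤ (R - 1) / (R + 1) := div_nonneg (by linarith) (by linarith)
  have hρm : ((R - 1) / (R + 1)) ^ (2 * m) ≤ (w / 2) ^ (2 * m) / v ^ (2 * m) := by
    rw [← div_pow]; exact pow_le_pow_left₀ hρ0 hρ _
  have hident : (w / 2) ^ (2 * m) * w =
      (1 / 4) ^ m * E ^ (1 + 2 * y) * (z ^ (2 * m + 1) * E ^ (2 * ((m : ℝ) - y))) := by
    have e1 : E ^ (1 + 2 * y) * E ^ (2 * ((m : ℝ) - y)) = E ^ (2 * m + 1) := by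
      rw [← Real.rpow_add hE, ← Real.rpow_natCast]; congr 1; push_cast; ring
    have e2 : (w / 2) ^ (2 * m) * w = (1 / 4) ^ m * (z ^ (2 * m + 1) * E ^ (2 * m + 1)) := by
      rw [hw, pow_succ, pow_succ, div_pow, mul_pow, pow_mul 2 2 m, one_div, inv_pow]; norm_num
      ring
    rw [e2, ← e1]; ring
  set G := z ^ (2 * m + 1) * E ^ (2 * ((m : ℝ) - y)) with hG
  set F := (1 / 4 : ℝ) ^ m * E ^ (1 + 2 * y) with hF
  have hF0 : 0 < F := by positivity
  have hvm : 0 < v ^ (2 * m) := by positivity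
  have hG1 : G / v ^ (2 * m) ≤ 0.37 := by rw [div_le_iff₀ hvm]; exact g1
  have hG2 : G * v / v ^ (2 * m) ≤ 0.6 := by rw [div_le_iff₀ hvm]; exact g2
  apply interval_core H hH m (by omega) R hR1 p hp1 hp2
  · have h1 : ((R - 1) / (R + 1)) ^ (2 * m) * (R - 1) ≤ (w / 2) ^ (2 * m) / v ^ (2 * m) * w :=
      mul_le_mul hρm (by linarith) (by linarith) (by positivity)
    have h2 : (w / 2) ^ (2 * m) / v ^ (2 * m) * w = F * (G / v ^ (2 * m)) := by
      rw [div_mul_eq_mul_div, hident]; ring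
    have h3 := mul_le_mul_of_nonneg_left hG1 hF0.le
    have h4 : 1.465 * E ^ (1 + 2 * y) * (1 / 4) ^ m = 1.465 * F := by rw [hF]; ring
    rw [h4]
    rw [h2] at h1
    linarith
  · have h0 : R ^ 2 - 1 ≤ 2 * (w * v) := by rw [hv]; nlinarith
    have h1 : ((R - 1) / (R + 1)) ^ (2 * m) * (R ^ 2 - 1) ≤
        (w / 2) ^ (2 * m) / v ^ (2 * m) * (2 * (w * v)) :=
      mul_le_mul hρm h0 (by nlinarith) (by positivity)
    have h2 : (w / 2) ^ (2 * m) / v ^ (2 * m) * (2 * (w * v)) =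
        2 * (F * (G * v / v ^ (2 * m))) := by
      rw [show (w / 2) ^ (2 * m) / v ^ (2 * m) * (2 * (w * v)) =
        2 * (((w / 2) ^ (2 * m) * w) * v / v ^ (2 * m)) by ring, hident]; ring
    have h3 := mul_le_mul_of_nonneg_left hG2 hF0.le
    have h4 : 1.465 * E ^ (1 + 2 * y) * (1 / 4) ^ m = 1.465 * F := by rw [hF]; ring
    rw [h4]
    rw [h2] at h1
    linarith

lemma zero_rule (H : ℝ) (hH : H ∈ Set.Ioo (0 : ℝ) (1 / 2)) (R : ℝ) (hR : 1 < R) (t : ℝ)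
    (ht : 0 < t) :
    |∫ x in (1 : ℝ)..R ^ 2, Real.exp (-x * t) * x ^ (-(H + 1 / 2))| * t ^ (1 / 2 - H) ≤
      2 * Real.log R := by
  obtain ⟨hH0, hH1⟩ := hH
  have hb : 1 < R ^ 2 := by nlinarith
  have hn0 : (0 : ℝ) ∉ Set.uIcc 1 (R ^ 2) := by
    rw [Set.uIcc_of_le hb.le]; intro h; linarith [h.1]
  have k1 : ∫ x in (1 : ℝ)..R ^ 2, x⁻¹ = 2 * Real.log R := by
    rw [integral_inv hn0, div_one, Real.log_pow]; norm_num
  have hnn : 0 ≤ ∫ x in (1 : ℝ)..R ^ 2, Real.exp (-x * t) * x ^ (-(H + 1 / 2)) := by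
    apply intervalIntegral.integral_nonneg hb.le
    intro x hx
    have : 0 < x := by linarith [hx.1]
    positivity
  rw [abs_of_nonneg hnn, ← k1, ← intervalIntegral.integral_mul_const]
  apply intervalIntegral.integral_mono_on hb.le
  · exact (intvl_mul (H + 1 / 2) (R ^ 2) hb (fun x => Real.exp (-x * t)) (by fun_prop)).mul_const _
  · apply ContinuousOn.intervalIntegrable
    apply ContinuousOn.inv₀ continuousOn_id
    intro x hx h0
    simp only [id] at h0
    exact hn0 (h0 ▸ hx)
  · intro x hx
    have hx0 : 0 < x := by linarith [hx.1]
    have hxt : 0 < x * t := by positivity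
    have h1 : (x * t) ^ (1 / 2 - H) ≤ Real.exp (x * t) := by
      have := _root_.rpow_one_add_le_one_add_mul_self (s := x * t - 1) (p := 1 / 2 - H)
        (by linarith) (by linarith) (by linarith)
      rw [add_sub_cancel] at this
      have h2 := Real.add_one_le_exp (x * t)
      nlinarith
    have e : x ^ (-(H + 1 / 2)) = x ^ (1 / 2 - H) * x⁻¹ := by
      rw [← Real.rpow_neg_one, ← Real.rpow_add hx0]; congr 1; ring
    rw [e]
    have h3 : Real.exp (-x * t) * (x * t) ^ (1 / 2 - H) ≤ 1 := by
      have := mul_le_mul_of_nonneg_left h1 (Real.exp_pos (-x * t)).le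
      rwa [← Real.exp_add, show -x * t + x * t = 0 by ring, Real.exp_zero] at this
    rw [Real.mul_rpow hx0.le ht.le] at h3
    have := mul_le_mul_of_nonneg_right h3 (inv_pos.mpr hx0).le
    linarith

lemma interval_one (H : ℝ) (hH : H ∈ Set.Ioo (0 : ℝ) (1 / 2)) (E z y : ℝ) (n N : ℕ)
    (hE : 0 < E) (hz0 : 1 / 2 ≤ z) (hz1 : z < 1) (hN0 : 1 ≤ N)
    (hn : 1 ≤ n) (hy : 0 < y) (hN : 2 * z * n * y = N) (hzn : 2 * z * n < n + 1)
    (hym : y ≤ 1) (R : ℝ) (hR : R = (1 + E) ^ z) :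
    ∃ ω l : Fin 1 → ℝ, (∀ i, 0 ≤ ω i) ∧ (∀ i, l i ∈ Set.Icc 1 (R ^ 2)) ∧
      ∀ t : ℝ, 0 < t →
      |(∫ x in (1 : ℝ)..R ^ 2, Real.exp (-x * t) * x ^ (-(H + 1 / 2))) -
        ∑ i, ω i * Real.exp (-(l i) * t)| * t ^ (1 / 2 - H) ≤
        (1.465 * E ^ (1 + 2 * y) * (1 / 4) ^ 1) * ((1 : ℕ) : ℝ) ^ (-H) := by
  have hz00 : 0 < z := by linarith
  have hR1 : 1 < R := by rw [hR]; exact Real.one_lt_rpow (by linarith) hz00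
  have hRw : R ≤ 1 + z * E := by
    rw [hR]
    exact _root_.rpow_one_add_le_one_add_mul_self (by linarith) hz00.le hz1.le
  have hR0 : 0 < R := by linarith
  have hJ1' : 2 * (R ^ 2 - 1) - 4 * R * Real.log R ≤ 2 * ((R - 1) ^ 3 / (R + 1)) := by
    have h := Real.le_log_one_add_of_nonneg (x := R - 1) (by linarith)
    rw [add_sub_cancel, show R - 1 + 2 = R + 1 by ring, div_le_iff₀ (by linarith)] at h
    have : 2 * ((R - 1) ^ 3 / (R + 1)) = 2 * (R - 1) ^ 3 / (R + 1) := by ring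
    rw [this, le_div_iff₀ (by linarith)]
    nlinarith
  have hJ0' : 2 / 3 * (R - 1) ^ 3 / R = 2 / 3 * ((R - 1) ^ 3 / R) := by ring
  obtain ⟨p, hp1, hp2, hJ0, hJ1⟩ := one_J R hR1
  have hc0 : 0 < (R - 1) ^ 3 := pow_pos (by linarith) 3
  rcases le_total E 1 with hE1 | hE1
  · have hE3 : (R - 1) ^ 3 ≤ E ^ (1 + 2 * y) := by
      calc (R - 1) ^ 3 ≤ E ^ 3 := pow_le_pow_left₀ (by linarith) (by nlinarith) 3
        _ = E ^ (3 : ℝ) := by rw [← Real.rpow_natCast]; norm_num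
        _ ≤ _ := Real.rpow_le_rpow_of_exponent_ge hE hE1 (by linarith)
    apply interval_core H hH 1 le_rfl R hR1 p hp1 hp2
    · rw [hJ0, hJ0']
      have : (R - 1) ^ 3 / R ≤ (R - 1) ^ 3 := div_le_self hc0.le hR1.le
      linarith
    · rw [hJ1]
      have : (R - 1) ^ 3 / (R + 1) ≤ (R - 1) ^ 3 / 2 := by
        apply div_le_div_of_nonneg_left hc0.le (by norm_num) (by linarith)
      linarith
  · have hexp : 2 * z ≤ 1 + 2 * y := by
      have hn1 : (1 : ℝ) ≤ n := by exact_mod_cast hn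
      have hN1 : (1 : ℝ) ≤ N := by exact_mod_cast hN0
      have h1 : 1 ≤ ((n : ℝ) + 1) * y := by nlinarith
      by_contra hcon
      push Not at hcon
      have h2 : (2 * z - 1) * n < 1 := by linarith
      have h3 : 2 * y * n < 1 := lt_of_lt_of_le' h2 (by nlinarith)
      nlinarith
    have hE2 : (R - 1) ^ 2 ≤ E ^ (1 + 2 * y) := by
      have h1 : R - 1 ≤ E ^ z := by
        have := Real.rpow_add_le_add_rpow (a := 1) (b := E) (p := z) (by norm_num) hE.le
          hz00.le hz1.le
        rw [Real.one_rpow, ← hR] at this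
        linarith
      calc (R - 1) ^ 2 ≤ (E ^ z) ^ 2 := pow_le_pow_left₀ (by linarith) h1 2
        _ = E ^ (2 * z) := by
          rw [← Real.rpow_natCast, ← Real.rpow_mul hE.le]; congr 1; push_cast; ring
        _ ≤ _ := Real.rpow_le_rpow_of_exponent_le hE1 hexp
    have hc2 : 0 < (R - 1) ^ 2 := pow_pos (by linarith) 2
    rcases le_total R 4 with hR4 | hR4
    · apply interval_core H hH 1 le_rfl R hR1 p hp1 hp2
      · rw [hJ0, hJ0']
        have : (R - 1) ^ 3 / R ≤ (R - 1) ^ 2 := by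
          rw [div_le_iff₀ hR0]; nlinarith
        linarith
      · rw [hJ1]
        have : (R - 1) ^ 3 / (R + 1) ≤ 0.6 * (R - 1) ^ 2 := by
          rw [div_le_iff₀ (by linarith)]; nlinarith
        linarith
    · refine ⟨fun _ => 0, fun _ => 1, fun _ => le_rfl, fun _ => ⟨le_rfl, by nlinarith⟩, ?_⟩
      intro t ht
      have h := zero_rule H hH R hR1 t ht
      simp only [zero_mul, Finset.sum_const_zero, sub_zero]
      refine h.trans ?_
      rw [Nat.cast_one, Real.one_rpow]
      have hl : Real.log R ≤ R / 4 - 1 + 2 * Real.log 2 := by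
        have h1 := Real.log_le_sub_one_of_pos (show 0 < R / 4 by positivity)
        rw [Real.log_div hR0.ne' (by norm_num), show (4 : ℝ) = 2 ^ 2 by norm_num,
          Real.log_pow] at h1
        push_cast at h1
        linarith
      have hl2 := Real.log_two_lt_d9
      nlinarith

lemma interval_all (H : ℝ) (hH : H ∈ Set.Ioo (0 : ℝ) (1 / 2)) (E z y : ℝ) (m n N : ℕ)
    (hE : 0 < E) (hz0 : 1 / 2 ≤ z) (hz1 : z < 1) (hN0 : 1 ≤ N)
    (hm : 1 ≤ m) (hn : 1 ≤ n) (hy : 0 < y) (hN : 2 * z * n * y = N) (hzn : 2 * z * n < n + 1)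
    (hym : y ≤ m) (hmy : (m : ℝ) < y + 1) (R : ℝ) (hR : R = (1 + E) ^ z) :
    ∃ ω l : Fin m → ℝ, (∀ i, 0 ≤ ω i) ∧ (∀ i, l i ∈ Set.Icc 1 (R ^ 2)) ∧
      ∀ t : ℝ, 0 < t →
      |(∫ x in (1 : ℝ)..R ^ 2, Real.exp (-x * t) * x ^ (-(H + 1 / 2))) -
        ∑ i, ω i * Real.exp (-(l i) * t)| * t ^ (1 / 2 - H) ≤
        (1.465 * E ^ (1 + 2 * y) * (1 / 4) ^ m) * (m : ℝ) ^ (-H) := by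
  rcases Nat.lt_or_ge 1 m with h | h
  · exact interval_two H hH E z y m n N hE hz0 hz1 h hn hy hN hzn hym hmy R hR
  · obtain rfl : m = 1 := by omega
    exact interval_one H hH E z y n N hE hz0 hz1 hN0 hn hy hN hzn (by simpa using hym) R hR

end Numeric

section Assembly

lemma scale_rule (H : ℝ) (m : ℕ) (b B : ℝ) (ω l : Fin m → ℝ)
    (h : ∀ t : ℝ, 0 < t →
      |(∫ x in (1 : ℝ)..b, Real.exp (-x * t) * x ^ (-(H + 1 / 2))) -
        ∑ i, ω i * Real.exp (-(l i) * t)| * t ^ (1 / 2 - H) ≤ B)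
    (hb : 1 < b) (a : ℝ) (ha : 0 < a) (t : ℝ) (ht : 0 < t) :
    |(∫ x in a..(a * b), Real.exp (-x * t) * x ^ (-(H + 1 / 2))) -
        ∑ i, (a ^ (1 / 2 - H) * ω i) * Real.exp (-(a * l i) * t)| ≤ B * t ^ (H - 1 / 2) := by
  have h1 := h (a * t) (by positivity)
  have e1 : (∫ x in a..(a * b), Real.exp (-x * t) * x ^ (-(H + 1 / 2))) =
      a ^ (1 / 2 - H) * ∫ x in (1 : ℝ)..b, Real.exp (-x * (a * t)) * x ^ (-(H + 1 / 2)) := by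
    have e2 := intervalIntegral.integral_comp_mul_left (a := 1) (b := b)
      (fun x => Real.exp (-x * t) * x ^ (-(H + 1 / 2))) ha.ne'
    rw [mul_one, smul_eq_mul] at e2
    have e3 : ∀ x ∈ Set.uIcc 1 b, Real.exp (-(a * x) * t) * (a * x) ^ (-(H + 1 / 2)) =
        a ^ (-(H + 1 / 2)) * (Real.exp (-x * (a * t)) * x ^ (-(H + 1 / 2))) := by
      intro x hx
      rw [Set.uIcc_of_le hb.le] at hx
      have hx0 : 0 < x := by linarith [hx.1]
      rw [Real.mul_rpow ha.le hx0.le, show -(a * x) * t = -x * (a * t) by ring]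
      ring
    rw [intervalIntegral.integral_congr e3, intervalIntegral.integral_const_mul] at e2
    rw [show 1 / 2 - H = 1 + -(H + 1 / 2) by ring, Real.rpow_add ha, Real.rpow_one, mul_assoc, e2,
      mul_inv_cancel_left₀ ha.ne']
  have e4 : ∑ i, (a ^ (1 / 2 - H) * ω i) * Real.exp (-(a * l i) * t) =
      a ^ (1 / 2 - H) * ∑ i, ω i * Real.exp (-(l i) * (a * t)) := by
    rw [Finset.mul_sum]
    refine Finset.sum_congr rfl fun i _ => ?_
    rw [show -(a * l i) * t = -(l i) * (a * t) by ring]; ring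
  rw [e1, e4, ← mul_sub, abs_mul, abs_of_pos (show 0 < a ^ (1 / 2 - H) by positivity)]
  rw [Real.mul_rpow ha.le ht.le] at h1
  have htp : 0 < t ^ (1 / 2 - H) := by positivity
  rw [show H - 1 / 2 = -(1 / 2 - H) by ring, Real.rpow_neg ht.le, ← div_eq_mul_inv,
    le_div_iff₀ htp]
  refine le_trans (le_of_eq ?_) h1
  ring

lemma sum_rule (H B r a : ℝ) (m n : ℕ) (hr : 1 < r) (ha : 0 < a) (ω l : Fin m → ℝ)
    (hω : ∀ i, 0 ≤ ω i) (hl : ∀ i, l i ∈ Set.Icc 1 r)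
    (h : ∀ t : ℝ, 0 < t →
      |(∫ x in (1 : ℝ)..r, Real.exp (-x * t) * x ^ (-(H + 1 / 2))) -
        ∑ i, ω i * Real.exp (-(l i) * t)| * t ^ (1 / 2 - H) ≤ B) :
    ∃ W L : Fin (n * m) → ℝ, (∀ j, 0 ≤ W j) ∧ (∀ j, L j ∈ Set.Icc a (a * r ^ n)) ∧
      ∀ t : ℝ, 0 < t →
        |(∫ x in a..(a * r ^ n), Real.exp (-x * t) * x ^ (-(H + 1 / 2))) -
          ∑ j, W j * Real.exp (-(L j) * t)| ≤ n * (B * t ^ (H - 1 / 2)) := by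
  have hr0 : 0 < r := by linarith
  let W2 : Fin n × Fin m → ℝ := fun q => (a * r ^ (q.1 : ℕ)) ^ (1 / 2 - H) * ω q.2
  let L2 : Fin n × Fin m → ℝ := fun q => (a * r ^ (q.1 : ℕ)) * l q.2
  refine ⟨fun j => W2 (finProdFinEquiv.symm j), fun j => L2 (finProdFinEquiv.symm j), ?_, ?_, ?_⟩
  · intro j
    exact mul_nonneg (by positivity) (hω _)
  · intro j
    set q := finProdFinEquiv.symm j
    have h1 := hl q.2
    have hp : 0 < r ^ (q.1 : ℕ) := by positivity
    have hp1 : 1 ≤ r ^ (q.1 : ℕ) := one_le_pow₀ hr.le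
    have hp2 : r ^ (q.1 : ℕ) * r ≤ r ^ n := by
      rw [← pow_succ]
      exact pow_le_pow_right₀ hr.le q.1.isLt
    simp only [L2]
    constructor
    · rw [mul_assoc]
      apply le_mul_of_one_le_right ha.le
      nlinarith [h1.1]
    · rw [mul_assoc]
      apply mul_le_mul_of_nonneg_left _ ha.le
      refine le_trans ?_ hp2
      exact mul_le_mul_of_nonneg_left h1.2 hp.le
  · intro t ht
    have hs : ∑ j, W2 (finProdFinEquiv.symm j) * Real.exp (-(L2 (finProdFinEquiv.symm j)) * t) =
        ∑ k ∈ Finset.range n, ∑ i, ((a * r ^ k) ^ (1 / 2 - H) * ω i) *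
          Real.exp (-((a * r ^ k) * l i) * t) := by
      rw [Equiv.sum_comp finProdFinEquiv.symm (fun q => W2 q * Real.exp (-(L2 q) * t)),
        Fintype.sum_prod_type, Finset.sum_range]
    have hI : (∫ x in a..(a * r ^ n), Real.exp (-x * t) * x ^ (-(H + 1 / 2))) =
        ∑ k ∈ Finset.range n, ∫ x in (a * r ^ k)..(a * r ^ k * r),
          Real.exp (-x * t) * x ^ (-(H + 1 / 2)) := by
      have := intervalIntegral.sum_integral_adjacent_intervals (μ := volume) (n := n)
        (a := fun k => a * r ^ k) (f := fun x => Real.exp (-x * t) * x ^ (-(H + 1 / 2))) (by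
          intro k _
          apply ContinuousOn.intervalIntegrable
          intro x hx
          have hk1 : 0 < a * r ^ k := by positivity
          have hk2 : 0 < a * r ^ (k + 1) := by positivity
          have hx0 : 0 < x := lt_of_lt_of_le (lt_min hk1 hk2) hx.1
          apply ContinuousAt.continuousWithinAt
          exact ContinuousAt.mul (by fun_prop)
            (Real.continuousAt_rpow_const x _ (Or.inl hx0.ne')))
      rw [pow_zero, mul_one] at this
      rw [← this]
      refine Finset.sum_congr rfl fun k _ => ?_
      rw [pow_succ, mul_assoc]
    rw [hs, hI, ← Finset.sum_sub_distrib]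
    refine (Finset.abs_sum_le_sum_abs _ _).trans ?_
    refine (Finset.sum_le_sum fun k _ => scale_rule H m r B ω l h hr (a * r ^ k)
      (by positivity) t ht).trans (le_of_eq ?_)
    simp

end Assembly


/-- Gauss–Jacobi quadrature error of approach A on `[ζ_0, ζ_n]`:
there exist nonnegative weights `ω_1, …, ω_{nm}` and nodes
`λ_1, …, λ_{nm} ∈ [ζ_0, ζ_n]` such that for every `t > 0`,
`|(1/Γ(1/2-H)) ∫_{ζ_0}^{ζ_n} e^(-xt) x^(-H-1/2) dx - Σ_j ω_j e^(-λ_j t)|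
  ≤ √(5π³/18) · n (e^(αβ) - 1) t^(H-1/2) / (Γ(1/2-H) 2^(2m+1) m^H)
      · exp((2β/A) √N log(e^(αβ) - 1))`. -/
theorem approachA_gauss_jacobi_error
    (H α β : ℝ) (N : ℕ) (hH : H ∈ Set.Ioo (0 : ℝ) (1 / 2))
    (hα : 0 < α) (hβ : 0 < β) (hN : 0 < N)
    (A : ℝ) (hA : A = (1 / H + 1 / (3 / 2 - H)) ^ ((1 : ℝ) / 2))
    (m n : ℕ) (hm : m = ⌈(β / A) * Real.sqrt N⌉₊) (hn : n = ⌊(A / β) * Real.sqrt N⌋₊)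
    (ζ : ℕ → ℝ)
    (hζ₀ : ζ 0 = Real.exp (-(α * Real.sqrt N) / ((3 / 2 - H) * A)))
    (hζn : ζ n = Real.exp ((α * Real.sqrt N) / (H * A)))
    (hζi : ∀ i ≤ n, ζ i = ζ 0 * (ζ n / ζ 0) ^ ((i : ℝ) / n)) :
    ∃ ω lam : Fin (n * m) → ℝ,
      (∀ j, 0 ≤ ω j) ∧ (∀ j, lam j ∈ Set.Icc (ζ 0) (ζ n)) ∧
      ∀ t : ℝ, 0 < t →
        |(1 / Real.Gamma (1 / 2 - H)) *
            (∫ x in Set.Ioc (ζ 0) (ζ n), Real.exp (-x * t) * x ^ (-H - 1 / 2)) -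
          ∑ j, ω j * Real.exp (-(lam j) * t)|
          ≤ Real.sqrt (5 * Real.pi ^ 3 / 18) *
              ((n : ℝ) * (Real.exp (α * β) - 1) * t ^ (H - 1 / 2)) /
                (Real.Gamma (1 / 2 - H) * 2 ^ (2 * m + 1) * (m : ℝ) ^ H) *
              Real.exp ((2 * β / A) * Real.sqrt N * Real.log (Real.exp (α * β) - 1)) := by
  obtain ⟨hH0, hH1⟩ := id hH
  have hNr : (0 : ℝ) < N := by exact_mod_cast hN
  set q := Real.sqrt N with hq
  have hq0 : 0 < q := Real.sqrt_pos.mpr hNr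
  have hqq : q * q = N := Real.mul_self_sqrt hNr.le
  have h32 : 0 < 3 / 2 - H := by linarith
  have hSpos : 0 < 1 / H + 1 / (3 / 2 - H) := by positivity
  have hA0 : 0 < A := by rw [hA]; positivity
  have hAA : A * A = 1 / H + 1 / (3 / 2 - H) := by
    rw [hA, ← Real.rpow_add hSpos]; norm_num
  have hζ00 : 0 < ζ 0 := by rw [hζ₀]; positivity
  have hn1 : 1 ≤ n := by
    by_contra hcon
    have hn0 : n = 0 := by omega
    rw [hn0, hζ₀] at hζn
    have := Real.exp_injective hζn
    have h1 : -(α * q) / ((3 / 2 - H) * A) < 0 :=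
      div_neg_of_neg_of_pos (by have := mul_pos hα hq0; linarith) (by positivity)
    have h2 : 0 < (α * q) / (H * A) := by positivity
    linarith
  have hn1r : (1 : ℝ) ≤ n := by exact_mod_cast hn1
  have hn0r : (0 : ℝ) < n := by linarith
  set X := A / β * q with hX
  set y := β / A * q with hy
  have hX0 : 0 < X := by positivity
  have hy0 : 0 < y := by positivity
  have hXy : X * y = N := by rw [hX, hy, ← hqq]; field_simp
  have hnX : (n : ℝ) ≤ X := by rw [hn]; exact Nat.floor_le hX0.le
  have hXn : X < n + 1 := by rw [hn]; exact Nat.lt_floor_add_one X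
  have hm1 : 1 ≤ m := by rw [hm]; exact Nat.one_le_ceil_iff.mpr hy0
  have hym : y ≤ m := by rw [hm]; exact Nat.le_ceil y
  have hmy : (m : ℝ) < y + 1 := by rw [hm]; exact Nat.ceil_lt_add_one hy0.le
  have hm0r : (0 : ℝ) < m := by exact_mod_cast hm1
  set E := Real.exp (α * β) - 1 with hE
  have hE0 : 0 < E := by
    have := Real.add_one_lt_exp (mul_pos hα hβ).ne'
    have := mul_pos hα hβ
    linarith
  set z := X / (2 * n) with hz
  have hzn : 2 * z * n = X := by rw [hz]; field_simp
  have hz0 : 1 / 2 ≤ z := by rw [hz, le_div_iff₀ (by positivity)]; linarith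
  have hz1 : z < 1 := by rw [hz, div_lt_one (by positivity)]; linarith
  obtain ⟨ω, l, h1, h2, h3⟩ := interval_all H hH E z y m n N hE0 hz0 hz1 hN hm1 hn1 hy0
    (by rw [hzn, hXy]) (by rw [hzn]; exact hXn) hym hmy ((1 + E) ^ z) rfl
  have hR1 : 1 < (1 + E) ^ z := Real.one_lt_rpow (by linarith) (by linarith)
  set r := ((1 + E) ^ z) ^ 2 with hr
  have hr1 : 1 < r := by rw [hr]; nlinarith
  have hζr : ζ n = ζ 0 * r ^ n := by
    have e1 : r ^ n = Real.exp (α * β * X) := by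
      rw [hr, hE, add_sub_cancel, ← Real.exp_mul, ← Real.exp_nat_mul, ← Real.exp_nat_mul]
      congr 1
      rw [← hzn]; push_cast; ring
    rw [e1, hζn, hζ₀, ← Real.exp_add]
    congr 1
    have e2 : α * β * X = α * q / A * (A * A) := by rw [hX]; field_simp
    rw [e2, hAA]
    field_simp
    ring
  obtain ⟨W, L, w1, w2, w3⟩ := sum_rule H _ r (ζ 0) m n hr1 hζ00 ω l h1 h2 h3
  rw [← hζr] at w2 w3
  have hle : ζ 0 ≤ ζ n := by
    rw [hζr]; exact le_mul_of_one_le_right hζ00.le (one_le_pow₀ hr1.le)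
  have hΓ : 0 < Real.Gamma (1 / 2 - H) := Real.Gamma_pos_of_pos (by linarith)
  refine ⟨fun j => 1 / Real.Gamma (1 / 2 - H) * W j, L,
    fun j => mul_nonneg (by positivity) (w1 j), w2, fun t ht => ?_⟩
  have e1 : (∫ x in Set.Ioc (ζ 0) (ζ n), Real.exp (-x * t) * x ^ (-H - 1 / 2)) =
      ∫ x in (ζ 0)..(ζ n), Real.exp (-x * t) * x ^ (-(H + 1 / 2)) := by
    rw [intervalIntegral.integral_of_le hle, show -(H + 1 / 2) = -H - 1 / 2 by ring]
  have e2 : ∑ j, 1 / Real.Gamma (1 / 2 - H) * W j * Real.exp (-(L j) * t) =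
      1 / Real.Gamma (1 / 2 - H) * ∑ j, W j * Real.exp (-(L j) * t) := by
    rw [Finset.mul_sum]
    exact Finset.sum_congr rfl fun j _ => by ring
  rw [e1, e2, ← mul_sub, abs_mul, abs_of_pos (show 0 < 1 / Real.Gamma (1 / 2 - H) by positivity)]
  refine (mul_le_mul_of_nonneg_left (w3 t ht)
    (show 0 ≤ 1 / Real.Gamma (1 / 2 - H) by positivity)).trans ?_
  have e3 : Real.exp ((2 * β / A) * q * Real.log E) = E ^ (2 * y) := by
    rw [Real.rpow_def_of_pos hE0, hy]; congr 1; ring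
  have e4 : E ^ (1 + 2 * y) = E * E ^ (2 * y) := by
    rw [Real.rpow_add hE0, Real.rpow_one]
  have e5 : (2 : ℝ) ^ (2 * m + 1) = 2 * 4 ^ m := by
    rw [pow_succ, pow_mul]; norm_num; ring
  have hC : 2.93 ≤ Real.sqrt (5 * Real.pi ^ 3 / 18) := by
    apply Real.le_sqrt_of_sq_le
    have := pow_le_pow_left₀ (by norm_num) Real.pi_gt_d4.le 3
    norm_num at this ⊢
    linarith
  rw [e3, e4, e5, Real.rpow_neg hm0r.le, one_div_pow]
  have key : 1 / Real.Gamma (1 / 2 - H) *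
      (n * (1.465 * (E * E ^ (2 * y)) * (1 / 4 ^ m) * ((m : ℝ) ^ H)⁻¹ * t ^ (H - 1 / 2))) =
      2.93 * (n * E * t ^ (H - 1 / 2) / (Real.Gamma (1 / 2 - H) * (2 * 4 ^ m) * (m : ℝ) ^ H) *
        E ^ (2 * y)) := by
    field_simp
    norm_num
  rw [key]
  refine (mul_le_mul_of_nonneg_right hC (by positivity)).trans (le_of_eq ?_)
  ring
end

section
/- Let H ∈ (0, 1/2), a > 0, T > 0, and let n_0 ≥ 2 be an integer. Then there exist nonnegative weights w_{0,1}, …, w_{0,n_0} and nodes λ_{0,1}, …, λ_{0,n_0} ∈ [0, a] such that for every t ∈ (0, T], | (1/Γ(1/2 − H)) ∫_0^a e^(−x t) x^(−H−1/2) dx − Σ_{k=1}^{n_0} w_{0,k} e^(−λ_{0,k} t) | ≤ (4√π / Γ(1/2 − H)) · a^(1/2 − H) · n_0^(3/2) · ( e a T / (8 (n_0 − 1)) )^(2 n_0). -/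
open MeasureTheory Real Set Finset

lemma gauss_abs {F : Type*} [NormedAddCommGroup F] [InnerProductSpace ℝ F]
    (M : F →ₗ[ℝ] F) (hM : M.IsSymmetric) (e : F) (n : ℕ) (hn : 0 < n) :
    ∃ w lam : Fin n → ℝ, (∀ k, 0 ≤ w k) ∧
      (∀ k, lam k = 0 ∨ ∃ v : F, ‖v‖ = 1 ∧ lam k = inner ℝ v (M v)) ∧
      ∀ m < 2 * n, inner ℝ e ((M ^ m) e) = ∑ k, w k * lam k ^ m := by
  classical
  let b : Fin n → F := fun i => (M ^ (i : ℕ)) e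
  let K : Submodule ℝ F := Submodule.span ℝ (Set.range b)
  have hmem : ∀ i < n, (M ^ i) e ∈ K := fun i hi =>
    Submodule.subset_span ⟨⟨i, hi⟩, rfl⟩
  have : FiniteDimensional ℝ K := FiniteDimensional.span_of_finite ℝ (Set.finite_range b)
  have hd : Module.finrank ℝ K ≤ n := by
    have := finrank_range_le_card (R := ℝ) b
    simpa [Set.finrank] using this
  let P := K.orthogonalProjectionOnto
  let T : K →ₗ[ℝ] K := P.toLinearMap ∘ₗ M ∘ₗ K.subtype
  have hTa : ∀ x : K, T x = P (M x) := fun x => rfl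
  have hin : ∀ (x : F) (y : K), inner ℝ (P x) y = inner ℝ x (y : F) := fun x y =>
    K.inner_orthogonalProjectionOnto_eq_of_mem_right y x
  have hin' : ∀ (x : F) (y : K), inner ℝ y (P x) = inner ℝ (y : F) x := fun x y =>
    K.inner_orthogonalProjectionOnto_eq_of_mem_left y x
  have hT : T.IsSymmetric := by
    intro x y
    rw [hTa, hTa, hin, hin']
    exact hM _ _
  have hPs : ∀ x ∈ K, ((P x : K) : F) = x := by
    intro x hx
    have := K.orthogonalProjectionOnto_mem_subspace_eq_self ⟨x, hx⟩
    exact congrArg Subtype.val this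
  have hpow : ∀ j ≤ n, (T ^ j) (P e) = P ((M ^ j) e) := by
    intro j
    induction j with
    | zero => intro _; simp
    | succ j ih =>
      intro hj
      rw [pow_succ', pow_succ', Module.End.mul_apply, Module.End.mul_apply, ih (by omega), hTa,
        hPs _ (hmem j (by omega))]
  have key : ∀ m < 2 * n, inner ℝ e ((M ^ m) e) = inner ℝ (P e) ((T ^ m) (P e)) := by
    intro m hm
    obtain ⟨i, j, hi, hj, rfl⟩ : ∃ i j, i < n ∧ j ≤ n ∧ m = i + j := by
      rcases le_or_gt n m with h | h
      · exact ⟨m - n, n, by omega, le_refl _, by omega⟩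
      · exact ⟨m, 0, h, by omega, by omega⟩
    rw [pow_add, pow_add, Module.End.mul_apply, Module.End.mul_apply, ← hM.pow i, ← hT.pow i,
      hpow i hi.le, hpow j hj, hin', hPs _ (hmem i hi)]
  obtain ⟨d, hdd⟩ : ∃ d, Module.finrank ℝ K = d := ⟨_, rfl⟩
  let B := hT.eigenvectorBasis hdd
  let ev := hT.eigenvalues hdd
  have hTB : ∀ i, T (B i) = ev i • B i := fun i => hT.apply_eigenvectorBasis hdd i
  have hTBp : ∀ i m, (T ^ m) (B i) = ev i ^ m • B i := by
    intro i m
    induction m with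
    | zero => simp
    | succ m ih => rw [pow_succ', Module.End.mul_apply, ih, map_smul, hTB, smul_smul, pow_succ]
  have key2 : ∀ m, inner ℝ (P e) ((T ^ m) (P e)) = ∑ k, (inner ℝ (P e) (B k)) ^ 2 * ev k ^ m := by
    intro m
    rw [← B.sum_inner_mul_inner]
    refine Finset.sum_congr rfl fun k _ => ?_
    rw [← hT.pow m, hTBp, inner_smul_left, real_inner_comm (P e)]
    simp
    ring
  rw [hdd] at hd
  refine ⟨fun k => if h : (k : ℕ) < d then (inner ℝ (P e) (B ⟨k, h⟩)) ^ 2 else 0,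
    fun k => if h : (k : ℕ) < d then ev ⟨k, h⟩ else 0, ?_, ?_, ?_⟩
  · intro k
    dsimp only
    split_ifs <;> positivity
  · intro k
    by_cases h : (k : ℕ) < d
    · right
      refine ⟨B ⟨k, h⟩, ?_, ?_⟩
      · rw [Submodule.norm_coe]
        exact B.orthonormal.1 ⟨k, h⟩
      · simp only [h, dif_pos]
        have h1 := hin' (M (B ⟨k, h⟩)) (B ⟨k, h⟩)
        rw [← hTa, hTB, inner_smul_right, real_inner_self_eq_norm_sq, B.orthonormal.1] at h1
        rw [← h1]; simp
    · left; simp [h]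
  · intro m hm
    rw [key m hm, key2]
    let g : ℕ → ℝ := fun k => if h : k < d then (inner ℝ (P e) (B ⟨k, h⟩)) ^ 2 * ev ⟨k, h⟩ ^ m else 0
    have e1 : ∑ k, (inner ℝ (P e) (B k)) ^ 2 * ev k ^ m = ∑ k ∈ Finset.range d, g k := by
      rw [← Fin.sum_univ_eq_sum_range]
      refine Finset.sum_congr rfl fun k _ => ?_
      simp [g]
    rw [e1]
    have e2 : ∑ k ∈ Finset.range d, g k = ∑ k ∈ Finset.range n, g k := by
      refine Finset.sum_subset (Finset.range_mono hd) fun k _ hk => ?_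
      simp only [Finset.mem_range] at hk
      simp [g, hk]
    rw [e2, ← Fin.sum_univ_eq_sum_range]
    refine Finset.sum_congr rfl fun k _ => ?_
    by_cases h : (k : ℕ) < d <;> simp [g, h]


lemma exp_interp (c : ℕ → ℝ) (hc : ∀ i, 0 ≤ c i) (N : ℕ) :
    ∃ b : ℕ → ℝ → ℝ, (∀ i, Continuous (b i)) ∧ (∀ i, N ≤ i → b i = 0) ∧ ∀ x, 0 ≤ x →
      ∃ φ : ℝ → ℝ, Continuous φ ∧ (∀ t, 0 ≤ t → |φ t| ≤ t ^ N / (N.factorial : ℝ)) ∧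
        ∀ t, Real.exp (-x * t) - ∑ i ∈ Finset.range N, b i t * x ^ i
          = φ t * ∏ i ∈ Finset.range N, (x - c i) := by
  induction N with
  | zero =>
    refine ⟨fun _ => 0, fun _ => continuous_zero, fun _ _ => rfl, fun x hx =>
      ⟨fun t => Real.exp (-x * t), by fun_prop, ?_, ?_⟩⟩
    · intro t ht
      simp only [abs_exp, pow_zero, Nat.factorial_zero, Nat.cast_one, div_one]
      rw [Real.exp_le_one_iff]; nlinarith
    · intro t; simp
  | succ N ih =>
    obtain ⟨b, hb, hb0, h⟩ := ih
    set d := c N with hd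
    have hd0 : 0 ≤ d := hc N
    -- the Duhamel operator
    let D : (ℝ → ℝ) → ℝ → ℝ := fun f t => ∫ s in (0:ℝ)..t, Real.exp (-d * (t - s)) * f s
    have hDalt : ∀ f t, D f t = Real.exp (-d * t) * ∫ s in (0:ℝ)..t, Real.exp (d * s) * f s := by
      intro f t
      simp only [D]
      rw [← intervalIntegral.integral_const_mul]
      congr 1; ext s
      rw [← mul_assoc, ← Real.exp_add]; congr 2; ring
    have hDc : ∀ f, Continuous f → Continuous (D f) := by
      intro f hf
      have : D f = fun t => Real.exp (-d * t) * ∫ s in (0:ℝ)..t, Real.exp (d * s) * f s :=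
        funext (hDalt f)
      rw [this]
      have h2 : Continuous fun t => ∫ s in (0:ℝ)..t, Real.exp (d * s) * f s :=
        intervalIntegral.continuous_primitive
          (fun _ _ => (by fun_prop : Continuous fun s => Real.exp (d * s) * f s).intervalIntegrable _ _) 0
      exact (by fun_prop : Continuous fun t => Real.exp (-d * t)).mul h2
    refine ⟨fun i t => (if i = 0 then Real.exp (-d * t) else 0) + d * D (b i) t -
      (if i = 0 then 0 else D (b (i - 1)) t), ?_, ?_, ?_⟩
    · intro i
      have h1 := hDc _ (hb i)
      have h2 := hDc _ (hb (i - 1))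
      by_cases hi : i = 0
      · simp only [hi, if_true]; subst hi; fun_prop
      · simp only [hi, if_false]; fun_prop
    · intro i hi
      have h0 : D 0 = 0 := by ext t; simp [D]
      ext t
      simp [hb0 i (by omega), hb0 (i - 1) (by omega), h0, show i ≠ 0 by omega]
    · intro x hx
      obtain ⟨φ, hφ, hφb, hφe⟩ := h x hx
      refine ⟨fun t => - D φ t, (hDc φ hφ).neg, ?_, ?_⟩
      · intro t ht
        rw [abs_neg]
        have hle : |D φ t| ≤ ∫ s in (0:ℝ)..t, s ^ N / (N.factorial : ℝ) := by
          rw [← Real.norm_eq_abs]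
          refine intervalIntegral.norm_integral_le_of_norm_le ht ?_
            ((by fun_prop : Continuous fun s : ℝ => s ^ N / (N.factorial : ℝ)).intervalIntegrable _ _)
          refine Filter.Eventually.of_forall fun s hs => ?_
          rw [norm_mul, Real.norm_eq_abs, Real.norm_eq_abs, Real.abs_exp]
          have h1 : Real.exp (-d * (t - s)) ≤ 1 := by
            rw [Real.exp_le_one_iff]; nlinarith [hs.2]
          calc _ ≤ 1 * |φ s| := by gcongr
            _ ≤ _ := by rw [one_mul]; exact hφb s hs.1.le
        refine hle.trans (le_of_eq ?_)
        rw [intervalIntegral.integral_div, integral_pow, Nat.factorial_succ]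
        push_cast
        have : (N.factorial : ℝ) ≠ 0 := by positivity
        field_simp
        simp
      · intro t
        have hDlin : D φ t * ∏ i ∈ Finset.range N, (x - c i) =
            D (fun s => Real.exp (-x * s)) t - ∑ i ∈ Finset.range N, D (b i) t * x ^ i := by
          simp only [D]
          rw [← intervalIntegral.integral_mul_const]
          simp_rw [← intervalIntegral.integral_mul_const]
          rw [← intervalIntegral.integral_finsetSum, ← intervalIntegral.integral_sub]
          · congr 1; ext s
            rw [mul_assoc, ← hφe s, mul_sub, Finset.mul_sum]
            congr 1
            exact Finset.sum_congr rfl fun i _ => by ring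
          · exact Continuous.intervalIntegrable (by fun_prop) _ _
          · refine Continuous.intervalIntegrable (continuous_finsetSum _ fun i _ => ?_) _ _
            have := hb i
            fun_prop
          · intro i _
            have := hb i
            exact Continuous.intervalIntegrable (by fun_prop) _ _
        have hDe : (x - d) * D (fun s => Real.exp (-x * s)) t =
            Real.exp (-d * t) - Real.exp (-x * t) := by
          rw [hDalt]
          have h1 : (x - d) * ∫ s in (0:ℝ)..t, Real.exp (d * s) * Real.exp (-x * s) =
              1 - Real.exp ((d - x) * t) := by
            rw [← intervalIntegral.integral_const_mul]
            rw [intervalIntegral.integral_eq_sub_of_hasDerivAt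
              (f := fun s => - Real.exp ((d - x) * s))]
            · simp; ring
            · intro s _
              have h3 := (((hasDerivAt_id s).const_mul (d - x)).exp).neg
              refine h3.congr_deriv ?_
              rw [← Real.exp_add]; simp only [id]
              rw [show d * s + -x * s = (d - x) * s by ring]; ring
            · exact Continuous.intervalIntegrable (by fun_prop) _ _
          calc _ = Real.exp (-d * t) * ((x - d) * ∫ s in (0:ℝ)..t, Real.exp (d * s) * Real.exp (-x * s)) := by ring
            _ = _ := by
              rw [h1, mul_sub, ← Real.exp_add, mul_one]; congr 2; ring
        have hsum : ∑ i ∈ Finset.range (N + 1), ((if i = 0 then Real.exp (-d * t) else 0) +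
            d * D (b i) t - (if i = 0 then 0 else D (b (i - 1)) t)) * x ^ i =
            Real.exp (-d * t) + d * ∑ i ∈ Finset.range N, D (b i) t * x ^ i
              - x * ∑ i ∈ Finset.range N, D (b i) t * x ^ i := by
          have h0 : D (b N) t = 0 := by simp [hb0 N le_rfl, D]
          simp_rw [sub_mul, add_mul]
          rw [Finset.sum_sub_distrib, Finset.sum_add_distrib]
          congr 1
          · congr 1
            · simp
            · rw [Finset.sum_range_succ, h0, Finset.mul_sum]
              simp [mul_assoc]
          · rw [Finset.sum_range_succ']
            simp only [Nat.add_eq_zero_iff, one_ne_zero, and_false, if_false, Nat.add_sub_cancel,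
              if_true, zero_mul, add_zero, Finset.mul_sum]
            exact Finset.sum_congr rfl fun i _ => by ring
        rw [hsum, Finset.prod_range_succ]
        linear_combination (x - d) * hDlin + hDe


lemma cheb_prod (m : ℕ) (hm : 0 < m) (y : ℝ) (hy : |y| ≤ 1) :
    |∏ k ∈ Finset.range m, (y - Real.cos ((2 * (k:ℝ) + 1) * π / (2 * m)))| ≤ 2 / 2 ^ m := by
  have hr := Polynomial.Chebyshev.roots_T_real m
  have hinj := (Finset.range m).nodup_map_iff_injOn.mp (Polynomial.Chebyshev.roots_T_real_nodup m)
  have hcard : (Polynomial.Chebyshev.T ℝ (m:ℤ)).roots.card =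
      (Polynomial.Chebyshev.T ℝ (m:ℤ)).natDegree := by
    rw [hr, Polynomial.Chebyshev.natDegree_T, Finset.card_val, Finset.card_image_of_injOn hinj]
    simp
  have h := Polynomial.C_leadingCoeff_mul_prod_multiset_X_sub_C hcard
  have h2 := congrArg (Polynomial.eval y) h
  rw [hr, Polynomial.Chebyshev.leadingCoeff_T, Finset.prod_map_val,
    Finset.prod_image hinj, Polynomial.eval_mul, Polynomial.eval_prod] at h2
  simp only [Polynomial.eval_C, Polynomial.eval_sub, Polynomial.eval_X, Int.natAbs_natCast] at h2
  have h3 := Polynomial.Chebyshev.abs_eval_T_real_le_one (m:ℤ) hy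
  rw [← h2, abs_mul, abs_of_pos (by positivity : (0:ℝ) < 2 ^ (m-1))] at h3
  obtain ⟨k, rfl⟩ : ∃ k, m = k + 1 := ⟨m - 1, by omega⟩
  rw [Nat.add_sub_cancel] at h3
  rw [le_div_iff₀ (by positivity), pow_succ]
  linarith

lemma cheb_prod' (a : ℝ) (ha : 0 < a) (m : ℕ) (hm : 0 < m) (x : ℝ) (hx : x ∈ Set.Icc 0 a) :
    |∏ k ∈ Finset.range m, (x - a / 2 * (1 + Real.cos ((2 * (k:ℝ) + 1) * π / (2 * m))))|
      ≤ 2 * (a / 4) ^ m := by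
  have hy : |2 * x / a - 1| ≤ 1 := by
    rw [abs_le]; constructor
    · have : 0 ≤ 2 * x / a := div_nonneg (by linarith [hx.1]) ha.le
      linarith
    · have : 2 * x / a ≤ 2 := by rw [div_le_iff₀ ha]; linarith [hx.2]
      linarith
  have h := cheb_prod m hm _ hy
  have e : ∏ k ∈ Finset.range m, (x - a / 2 * (1 + Real.cos ((2 * (k:ℝ) + 1) * π / (2 * m)))) =
      (a / 2) ^ m * ∏ k ∈ Finset.range m, (2 * x / a - 1 - Real.cos ((2 * (k:ℝ) + 1) * π / (2 * m))) := by
    have hp : (a / 2) ^ m = ∏ _k ∈ Finset.range m, a / 2 := by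
      rw [Finset.prod_const, Finset.card_range]
    rw [hp, ← Finset.prod_mul_distrib]
    refine Finset.prod_congr rfl fun k _ => ?_
    field_simp
    ring
  rw [e, abs_mul, abs_of_pos (by positivity)]
  calc _ ≤ (a / 2) ^ m * (2 / 2 ^ m) := by gcongr
    _ = _ := by
      rw [show a / 4 = a / 2 / 2 by ring, div_pow (a / 2)]; ring

lemma const_bound (n : ℕ) (hn : 2 ≤ n) :
    16 * (1 / 4 : ℝ) ^ (2 * n) / ((2 * n).factorial : ℝ) ≤
      4 * Real.sqrt Real.pi * (n : ℝ) ^ ((3 : ℝ) / 2) *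
        (Real.exp 1 / (8 * ((n : ℝ) - 1))) ^ (2 * n) := by
  have hn' : (2:ℝ) ≤ n := by exact_mod_cast hn
  have h1 := Stirling.le_factorial_stirling (2 * n)
  have h2 : (((2 * n : ℕ) : ℝ) / Real.exp 1) ^ (2 * n) ≤ ((2 * n).factorial : ℝ) := by
    refine le_trans ?_ h1
    have : 1 ≤ √(2 * π * ((2 * n : ℕ) : ℝ)) := by
      rw [Real.one_le_sqrt]; push_cast; nlinarith [Real.pi_gt_three]
    exact le_mul_of_one_le_left (by positivity) this
  have h3 : 16 ≤ 4 * Real.sqrt Real.pi * (n : ℝ) ^ ((3 : ℝ) / 2) := by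
    have e1 : (1.7 : ℝ) ≤ √π := by
      apply Real.le_sqrt_of_sq_le; nlinarith [Real.pi_gt_three]
    have e2 : (1.4 : ℝ) ≤ √n := by
      apply Real.le_sqrt_of_sq_le; nlinarith
    have e3 : (n : ℝ) ^ ((3 : ℝ) / 2) = n * √n := by
      rw [show (3:ℝ)/2 = 1 + 1/2 by norm_num, Real.rpow_add (by linarith), Real.rpow_one,
        Real.sqrt_eq_rpow]
    rw [e3]
    have e4 : 2 * 1.4 ≤ n * √n := by gcongr
    nlinarith
  have h4 : (1 / 4 : ℝ) ^ (2 * n) / ((2 * n).factorial : ℝ) ≤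
      (Real.exp 1 / (8 * ((n : ℝ) - 1))) ^ (2 * n) := by
    rw [div_le_iff₀ (by positivity)]
    have hpos : 0 < Real.exp 1 / (8 * ((n : ℝ) - 1)) := by
      apply div_pos (Real.exp_pos 1); linarith
    calc _ ≤ (Real.exp 1 / (8 * ((n : ℝ) - 1)) * (((2 * n : ℕ) : ℝ) / Real.exp 1)) ^ (2 * n) := by
            gcongr
            push_cast
            have : 0 < (n:ℝ) - 1 := by linarith
            rw [div_mul_div_comm, div_le_div_iff₀ (by norm_num) (by positivity)]
            nlinarith [Real.exp_pos 1]
      _ ≤ _ := by rw [mul_pow]; gcongr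
  rw [mul_div_assoc]
  gcongr

lemma rinner_mul (x y : ℝ) : inner ℝ x y = x * y := by
  rw [real_inner_comm]; rfl

lemma quad_exists (a α : ℝ) (ha : 0 < a) (hα : -1 < α) (n : ℕ) (hn : 0 < n) :
    ∃ w lam : Fin n → ℝ, (∀ k, 0 ≤ w k) ∧ (∀ k, lam k ∈ Set.Icc 0 a) ∧
      ∀ m < 2 * n, ∫ x in Set.Ioc 0 a, x ^ m * x ^ α = ∑ k, w k * lam k ^ m := by
  have hint : IntegrableOn (fun x : ℝ => x ^ α) (Set.Ioc 0 a) := by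
    rw [← intervalIntegrable_iff_integrableOn_Ioc_of_le ha.le]
    exact intervalIntegral.intervalIntegrable_rpow' hα
  have hmeas : Measurable fun x : ℝ => ENNReal.ofReal (x ^ α) := by fun_prop
  let μ : Measure ℝ := (volume.restrict (Set.Ioc 0 a)).withDensity fun x => ENNReal.ofReal (x ^ α)
  have hfin : IsFiniteMeasure μ := isFiniteMeasure_withDensity_ofReal hint.2
  let g : ℝ → ℝ := fun x => max 0 (min x a)
  have hg : Measurable g := by fun_prop
  have hg0 : ∀ x, 0 ≤ g x := fun x => le_max_left _ _
  have hga : ∀ x, g x ≤ a := fun x => max_le ha.le (min_le_right _ _)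
  have hmul : ∀ f : Lp ℝ 2 μ, MemLp (fun x => g x * f x) 2 μ := by
    intro f
    refine MemLp.of_le_mul (c := a) (Lp.memLp f)
      (hg.aestronglyMeasurable.mul (Lp.aestronglyMeasurable f)) ?_
    refine Filter.Eventually.of_forall fun x => ?_
    rw [norm_mul, Real.norm_of_nonneg (hg0 x)]
    gcongr
    exact hga x
  let M : Lp ℝ 2 μ →ₗ[ℝ] Lp ℝ 2 μ :=
    { toFun := fun f => (hmul f).toLp _
      map_add' := by
        intro f f'
        rw [← MemLp.toLp_add]
        refine MemLp.toLp_congr _ _ ?_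
        filter_upwards [Lp.coeFn_add f f'] with x hx
        simp only [hx, Pi.add_apply]; ring
      map_smul' := by
        intro c f
        simp only [RingHom.id_apply]
        rw [← MemLp.toLp_const_smul]
        refine MemLp.toLp_congr _ _ ?_
        filter_upwards [Lp.coeFn_smul c f] with x hx
        simp only [hx, Pi.smul_apply, smul_eq_mul]; ring }
  have hMa : ∀ f : Lp ℝ 2 μ, M f =ᵐ[μ] fun x => g x * f x := fun f => (hmul f).coeFn_toLp
  have hM : M.IsSymmetric := by
    intro f f'
    rw [L2.inner_def, L2.inner_def]
    refine integral_congr_ae ?_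
    filter_upwards [hMa f, hMa f'] with x h1 h2
    simp only [h1, h2, rinner_mul]; ring
  have hone : MemLp (fun _ : ℝ => (1:ℝ)) 2 μ := memLp_const 1
  let e : Lp ℝ 2 μ := hone.toLp _
  have hpow : ∀ m : ℕ, (M ^ m) e =ᵐ[μ] fun x => g x ^ m := by
    intro m
    induction m with
    | zero => exact hone.coeFn_toLp
    | succ m ih =>
      rw [pow_succ', Module.End.mul_apply]
      filter_upwards [ih, hMa ((M ^ m) e)] with x h1 h2
      rw [h2, h1, pow_succ']
  obtain ⟨w, lam, hw, hlam, hex⟩ := gauss_abs M hM e n hn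
  refine ⟨w, lam, hw, ?_, ?_⟩
  · intro k
    rcases hlam k with h | ⟨v, hv, h⟩
    · rw [h]; exact ⟨le_rfl, ha.le⟩
    · have e1 : inner ℝ v (M v) = ∫ x, g x * (v x) ^ 2 ∂μ := by
        rw [L2.inner_def]
        refine integral_congr_ae ?_
        filter_upwards [hMa v] with x h1
        simp only [h1, rinner_mul]; ring
      have e2 : ∫ x, (v x) ^ 2 ∂μ = 1 := by
        have h3 : inner ℝ v v = (1:ℝ) := by rw [real_inner_self_eq_norm_sq, hv]; norm_num
        rw [L2.inner_def] at h3
        rw [← h3]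
        refine integral_congr_ae (Filter.Eventually.of_forall fun x => ?_)
        simp only [rinner_mul]; ring
      have i2 : Integrable (fun x => (v x) ^ 2) μ := (Lp.memLp v).integrable_sq
      rw [h, e1]
      constructor
      · exact integral_nonneg fun x => mul_nonneg (hg0 x) (sq_nonneg _)
      · calc _ ≤ ∫ x, a * (v x) ^ 2 ∂μ := by
              refine integral_mono_of_nonneg
                (Filter.Eventually.of_forall fun x => mul_nonneg (hg0 x) (sq_nonneg _))
                (i2.const_mul a) (Filter.Eventually.of_forall fun x => ?_)
              exact mul_le_mul_of_nonneg_right (hga x) (sq_nonneg _)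
          _ = a := by rw [integral_const_mul, e2, mul_one]
  · intro m hm
    rw [← hex m hm, L2.inner_def]
    have e1 : ∫ x, inner ℝ (e x) (((M ^ m) e : Lp ℝ 2 μ) x) ∂μ = ∫ x, g x ^ m ∂μ := by
      refine integral_congr_ae ?_
      filter_upwards [hpow m, hone.coeFn_toLp] with x h1 h2
      have h3 : e x = 1 := h2
      rw [h1, h3, rinner_mul, one_mul]
    rw [e1, integral_withDensity_eq_integral_toReal_smul hmeas
      (Filter.Eventually.of_forall fun x => ENNReal.ofReal_lt_top)]
    refine setIntegral_congr_fun measurableSet_Ioc fun x hx => ?_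
    have h1 : g x = x := by
      simp only [g]; rw [min_eq_left hx.2, max_eq_right hx.1.le]
    simp only [h1, smul_eq_mul]
    rw [ENNReal.toReal_ofReal (Real.rpow_nonneg hx.1.le _), mul_comm]

/-- polynomial approximation of `exp (-x t)` vanishing at `0`. -/
lemma exp_approx (a t : ℝ) (ha : 0 < a) (ht : 0 ≤ t) (n : ℕ) (hn : 2 ≤ n) :
    ∃ b : ℕ → ℝ, ∀ x ∈ Set.Icc 0 a,
      |Real.exp (-x * t) - ∑ i ∈ Finset.range (2 * n), b i * x ^ i| ≤
        t ^ (2 * n) / ((2 * n).factorial : ℝ) * (2 * (a / 4) ^ (2 * n - 1)) * x := by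
  obtain ⟨m, hm⟩ : ∃ m, 2 * n = m + 1 := ⟨2 * n - 1, by omega⟩
  let c : ℕ → ℝ := fun i => if i = 0 then 0 else
    a / 2 * (1 + Real.cos ((2 * ((i - 1 : ℕ):ℝ) + 1) * π / (2 * m)))
  have hc : ∀ i, 0 ≤ c i := by
    intro i
    simp only [c]
    split_ifs
    · exact le_rfl
    · refine mul_nonneg (by linarith) ?_
      linarith [Real.neg_one_le_cos ((2 * ((i - 1 : ℕ):ℝ) + 1) * π / (2 * m))]
  obtain ⟨b, -, -, h⟩ := exp_interp c hc (2 * n)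
  refine ⟨fun i => b i t, fun x hx => ?_⟩
  obtain ⟨φ, -, hφ, he⟩ := h x hx.1
  rw [he t, abs_mul, mul_assoc]
  have h1 : |∏ i ∈ Finset.range (2 * n), (x - c i)| ≤ 2 * (a / 4) ^ (2 * n - 1) * x := by
    rw [hm, Finset.prod_range_succ, ← Finset.prod_range_succ, Finset.prod_range_succ', abs_mul]
    have h2 := cheb_prod' a ha m (by omega) x hx
    simp only [c, Nat.add_sub_cancel, Nat.add_eq_zero_iff, one_ne_zero, and_false, if_false, if_true,
      sub_zero, abs_of_nonneg hx.1]
    exact mul_le_mul_of_nonneg_right h2 hx.1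
  exact mul_le_mul (hφ t ht) h1 (abs_nonneg _) (by positivity)

theorem approachB_gauss_jacobi_error
    (H a T : ℝ) (n₀ : ℕ) (hH : H ∈ Set.Ioo (0 : ℝ) (1 / 2))
    (ha : 0 < a) (hT : 0 < T) (hn₀ : 2 ≤ n₀) :
    ∃ w lam : Fin n₀ → ℝ,
      (∀ k, 0 ≤ w k) ∧ (∀ k, lam k ∈ Set.Icc (0 : ℝ) a) ∧
      ∀ t ∈ Set.Ioc (0 : ℝ) T,
        |(1 / Real.Gamma (1 / 2 - H)) *
            (∫ x in Set.Ioc (0 : ℝ) a, Real.exp (-x * t) * x ^ (-H - 1 / 2)) -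
          ∑ k, w k * Real.exp (-(lam k) * t)|
          ≤ 4 * Real.sqrt Real.pi / Real.Gamma (1 / 2 - H) *
              a ^ ((1 : ℝ) / 2 - H) * (n₀ : ℝ) ^ ((3 : ℝ) / 2) *
              (Real.exp 1 * a * T / (8 * ((n₀ : ℝ) - 1))) ^ (2 * n₀) := by
  obtain ⟨hH0, hH1⟩ := hH
  set α : ℝ := -H - 1 / 2 with hα
  have hα1 : -1 < α := by rw [hα]; linarith
  obtain ⟨w, lam, hw, hlam, hex⟩ := quad_exists a α ha hα1 n₀ (by omega)
  set G := Real.Gamma (1 / 2 - H) with hG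
  have hGpos : 0 < G := Real.Gamma_pos_of_pos (by linarith)
  refine ⟨fun k => w k / G, lam, fun k => div_nonneg (hw k) hGpos.le, hlam, fun t ht => ?_⟩
  obtain ⟨b, hb⟩ := exp_approx a t ha ht.1.le n₀ hn₀
  set C := t ^ (2 * n₀) / ((2 * n₀).factorial : ℝ) * (2 * (a / 4) ^ (2 * n₀ - 1)) with hC
  have hC0 : 0 ≤ C := by have := ht.1; positivity
  have hint : IntegrableOn (fun x : ℝ => x ^ α) (Set.Ioc 0 a) := by
    rw [← intervalIntegrable_iff_integrableOn_Ioc_of_le ha.le]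
    exact intervalIntegral.intervalIntegrable_rpow' hα1
  have hintc : ∀ f : ℝ → ℝ, Continuous f →
      IntegrableOn (fun x : ℝ => f x * x ^ α) (Set.Ioc 0 a) := by
    intro f hf
    rw [← integrableOn_Icc_iff_integrableOn_Ioc] at hint ⊢
    exact hint.continuousOn_mul hf.continuousOn isCompact_Icc
  let h : ℝ → ℝ := fun x => ∑ i ∈ Finset.range (2 * n₀), b i * x ^ i
  have hhc : Continuous h := by fun_prop
  have hh : ∫ x in Set.Ioc 0 a, h x * x ^ α = ∑ k, w k * h (lam k) := by
    have e1 : ∀ x : ℝ, h x * x ^ α = ∑ i ∈ Finset.range (2 * n₀), b i * (x ^ i * x ^ α) := by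
      intro x; simp only [h, Finset.sum_mul, mul_assoc]
    simp_rw [e1]
    rw [integral_finsetSum _ (fun i _ => (hintc (fun x => x ^ i) (by fun_prop)).const_mul (b i))]
    simp only [h, Finset.mul_sum]
    rw [Finset.sum_comm]
    refine Finset.sum_congr rfl fun i hi => ?_
    rw [integral_const_mul, hex i (Finset.mem_range.mp hi), Finset.mul_sum]
    exact Finset.sum_congr rfl fun k _ => by ring
  let I1 : ℝ := ∫ x in Set.Ioc 0 a, x * x ^ α
  have hI1s : I1 = ∑ k, w k * lam k := by
    have := hex 1 (by omega)
    simpa using this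
  have hI1 : I1 ≤ a ^ ((1:ℝ) / 2 - H) * a := by
    have e1 : I1 = ∫ x in (0:ℝ)..a, x ^ (α + 1) := by
      rw [intervalIntegral.integral_of_le ha.le]
      refine setIntegral_congr_fun measurableSet_Ioc fun x hx => ?_
      rw [Real.rpow_add hx.1, Real.rpow_one, mul_comm]
    rw [e1, integral_rpow (Or.inl (by linarith)), Real.zero_rpow (by linarith), sub_zero,
      show α + 1 + 1 = (1 / 2 - H) + 1 by rw [hα]; ring, Real.rpow_add ha, Real.rpow_one]
    exact div_le_self (by positivity) (by linarith)
  have hmain : |(∫ x in Set.Ioc (0 : ℝ) a, Real.exp (-x * t) * x ^ α) -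
      ∑ k, w k * Real.exp (-(lam k) * t)| ≤ 2 * C * I1 := by
    have e1 : (∫ x in Set.Ioc (0 : ℝ) a, Real.exp (-x * t) * x ^ α) -
        ∫ x in Set.Ioc 0 a, h x * x ^ α =
        ∫ x in Set.Ioc 0 a, (Real.exp (-x * t) - h x) * x ^ α := by
      rw [← integral_sub (hintc _ (by fun_prop)) (hintc h hhc)]
      simp only [sub_mul]
    have b1 : |∫ x in Set.Ioc 0 a, (Real.exp (-x * t) - h x) * x ^ α| ≤ C * I1 := by
      simp only [I1]
      rw [← integral_const_mul, ← Real.norm_eq_abs]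
      refine norm_integral_le_of_norm_le ((hintc (fun x => x) continuous_id).const_mul C) ?_
      refine (ae_restrict_iff' measurableSet_Ioc).mpr (Filter.Eventually.of_forall fun x hx => ?_)
      rw [norm_mul, Real.norm_of_nonneg (Real.rpow_nonneg hx.1.le α), ← mul_assoc, Real.norm_eq_abs]
      exact mul_le_mul_of_nonneg_right (hb x ⟨hx.1.le, hx.2⟩) (Real.rpow_nonneg hx.1.le α)
    have b2 : |∑ k, w k * (Real.exp (-(lam k) * t) - h (lam k))| ≤ C * I1 := by
      rw [hI1s, Finset.mul_sum]
      refine (Finset.abs_sum_le_sum_abs _ _).trans (Finset.sum_le_sum fun k _ => ?_)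
      rw [abs_mul, abs_of_nonneg (hw k)]
      calc _ ≤ w k * (C * lam k) := mul_le_mul_of_nonneg_left (hb _ (hlam k)) (hw k)
        _ = _ := by ring
    have e2 : (∫ x in Set.Ioc (0 : ℝ) a, Real.exp (-x * t) * x ^ α) -
        ∑ k, w k * Real.exp (-(lam k) * t) =
        (∫ x in Set.Ioc 0 a, (Real.exp (-x * t) - h x) * x ^ α) -
          ∑ k, w k * (Real.exp (-(lam k) * t) - h (lam k)) := by
      rw [← e1, hh]
      simp only [mul_sub, Finset.sum_sub_distrib]
      ring
    rw [e2]
    refine (abs_sub _ _).trans ?_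
    linarith
  have e3 : (1 / G) * (∫ x in Set.Ioc (0 : ℝ) a, Real.exp (-x * t) * x ^ α) -
      ∑ k, w k / G * Real.exp (-(lam k) * t) =
      (1 / G) * ((∫ x in Set.Ioc (0 : ℝ) a, Real.exp (-x * t) * x ^ α) -
      ∑ k, w k * Real.exp (-(lam k) * t)) := by
    rw [mul_sub, Finset.mul_sum]
    congr 1
    exact Finset.sum_congr rfl fun k _ => by ring
  rw [e3, abs_mul, abs_of_pos (by positivity)]
  have hA : 0 < a ^ ((1:ℝ) / 2 - H) := Real.rpow_pos_of_pos ha _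
  have h5 : 2 * C * I1 ≤ a ^ ((1:ℝ) / 2 - H) * (a * T) ^ (2 * n₀) *
      (16 * (1 / 4 : ℝ) ^ (2 * n₀) / ((2 * n₀).factorial : ℝ)) := by
    have hCT : C ≤ T ^ (2 * n₀) / ((2 * n₀).factorial : ℝ) * (2 * (a / 4) ^ (2 * n₀ - 1)) := by
      rw [hC]
      have := ht.1.le
      have := ht.2
      gcongr
    calc 2 * C * I1 ≤ 2 * C * (a ^ ((1:ℝ) / 2 - H) * a) := by gcongr
      _ ≤ 2 * (T ^ (2 * n₀) / ((2 * n₀).factorial : ℝ) * (2 * (a / 4) ^ (2 * n₀ - 1))) *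
          (a ^ ((1:ℝ) / 2 - H) * a) := by gcongr
      _ = _ := by
        obtain ⟨m, hm⟩ : ∃ m, 2 * n₀ = m + 1 := ⟨2 * n₀ - 1, by omega⟩
        rw [hm, Nat.add_sub_cancel, mul_pow, div_pow, div_pow, one_pow, pow_succ (4 : ℝ)]
        field_simp
        ring
  have h6 := const_bound n₀ hn₀
  have hn1 : (2:ℝ) ≤ n₀ := by exact_mod_cast hn₀
  calc _ ≤ 1 / G * (a ^ ((1:ℝ) / 2 - H) * (a * T) ^ (2 * n₀) *
      (4 * Real.sqrt Real.pi * (n₀ : ℝ) ^ ((3 : ℝ) / 2) *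
        (Real.exp 1 / (8 * ((n₀ : ℝ) - 1))) ^ (2 * n₀))) := by
        refine mul_le_mul_of_nonneg_left ((hmain.trans h5).trans ?_) (by positivity)
        exact mul_le_mul_of_nonneg_left h6 (by positivity)
    _ = _ := by
      rw [show Real.exp 1 * a * T / (8 * ((n₀ : ℝ) - 1)) =
        (a * T) * (Real.exp 1 / (8 * ((n₀ : ℝ) - 1))) by ring, mul_pow]
      ring
end
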